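/- Let θ ∈ ℝⁿ with |θ| = 1 and x ∈ ℝⁿ with θ·x = 0, and fix r ∈ (0,1). For all sufficiently large s > 0 the map A (with v_− = sθ, x_− = x) has a unique fixed point y_−^{(s)} in M_r; set a(s) := sθ + ∫_{−∞}^∞ F(z_−(sθ,τ)+x+y_−^{(s)}(τ)) dτ, b_sc(sθ,x) := l + l₁ + l₂, and W(sθ,x) := ∫_{−∞}^0 ∫_{−∞}^σ (F^l(z_−(sθ,τ)+x) − F^l(z_−(sθ,τ))) dτ dσ − ∫_0^∞ ∫_σ^∞ (F^l(z_+(a(s),τ)+x) − F^l(z_+(a(s),τ))) dτ dσ. Then lim_{s→+∞} s² θ·(b_sc(sθ,x) − W(sθ,x)) = −∫_{−∞}^∞ V^s(τθ + x) dτ. -/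

import Mathlib

open MeasureTheory Real Filter Set Topology RealInnerProductSpace

noncomputable section

namespace Paper

/-- ℝⁿ -/
abbrev Euc (n : ℕ) : Type := EuclideanSpace ℝ (Fin n)

variable {n : ℕ}

/-- the norm `sup_{t ≤ 0} ‖f t‖ + sup_{t ≥ 0} ‖f t‖/(1+t)` on the space `M_r`. -/
def Mnorm (f : ℝ → Euc n) : ℝ :=
  sSup ((fun t => ‖f t‖) '' Iic 0) + sSup ((fun t => ‖f t‖ / (1 + t)) '' Ici 0)

/-- membership in the complete metric space `M_r`. -/
def MemM (r : ℝ) (f : ℝ → Euc n) : Prop :=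
  Continuous f ∧ BddAbove ((fun t => ‖f t‖) '' Iic 0) ∧
    BddAbove ((fun t => ‖f t‖ / (1 + t)) '' Ici 0) ∧ Mnorm f ≤ r

/-- the long range decay conditions on `V^l`. -/
def LongRange (α βl0 βl1 βl2 : ℝ) (Vl : Euc n → ℝ) : Prop :=
  ContDiff ℝ 2 Vl ∧
    (∀ x, |Vl x| ≤ βl0 * (1 + ‖x‖) ^ (-α)) ∧
    (∀ x, ‖gradient Vl x‖ ≤ βl1 * (1 + ‖x‖) ^ (-(α + 1))) ∧
    (∀ x, ‖iteratedFDeriv ℝ 2 Vl x‖ ≤ βl2 * (1 + ‖x‖) ^ (-(α + 2)))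

/-- the short range decay conditions on `V^s`. -/
def ShortRange (α βs1 βs2 βs3 : ℝ) (Vs : Euc n → ℝ) : Prop :=
  ContDiff ℝ 2 Vs ∧
    (∀ x, |Vs x| ≤ βs1 * (1 + ‖x‖) ^ (-(α + 1))) ∧
    (∀ x, ‖gradient Vs x‖ ≤ βs2 * (1 + ‖x‖) ^ (-(α + 2))) ∧
    (∀ x, ‖iteratedFDeriv ℝ 2 Vs x‖ ≤ βs3 * (1 + ‖x‖) ^ (-(α + 3)))

/-- `z` is a C² solution of `z'' = Fl ∘ z` with `z 0 = x0`, `z' → w` along the filter `l`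
(`atBot` for `z_-`, `atTop` for `z_+`), satisfying the growth bound `‖z t - x0 - t w‖ ≤ C |t|`. -/
def IsFreeSol (Fl : Euc n → Euc n) (x0 w : Euc n) (l : Filter ℝ) (C : ℝ)
    (z : ℝ → Euc n) : Prop :=
  ContDiff ℝ 2 z ∧ (∀ t, deriv (deriv z) t = Fl (z t)) ∧ z 0 = x0 ∧
    Tendsto (fun t => deriv z t) l (𝓝 w) ∧ ∀ t, ‖z t - x0 - t • w‖ ≤ C * |t|

/-- the map `A` (or `𝒜` when `xm = 0` and `zm` already contains the base point). -/
def Aop (Fl F : Euc n → Euc n) (zm : ℝ → Euc n) (xm : Euc n)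
    (f : ℝ → Euc n) (t : ℝ) : Euc n :=
  ∫ σ in Iic t, ∫ τ in Iic σ, (F (zm τ + xm + f τ) - Fl (zm τ))

/-- the vector `l(v_-,x_-,y_-)`. -/
def lInt (Fl Fs F : Euc n → Euc n) (zm : ℝ → Euc n) (xm : Euc n) (ym : ℝ → Euc n) : Euc n :=
  (∫ σ in Iic (0:ℝ), ∫ τ in Iic σ, (F (zm τ + xm + ym τ) - Fl (zm τ))) -
    ∫ σ in Ici (0:ℝ), ∫ τ in Ici σ, Fs (zm τ + xm + ym τ)

/-- the vector `l₁(v_-,x_-)`. -/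
def l1Int (Fl : Euc n → Euc n) (zp : ℝ → Euc n) (xm : Euc n) : Euc n :=
  -∫ σ in Ici (0:ℝ), ∫ τ in Ici σ, (Fl (zp τ + xm) - Fl (zp τ))

/-- the vector `l₂(v_-,x_-,y_-)`. -/
def l2Int (Fl : Euc n → Euc n) (zm zp : ℝ → Euc n) (xm : Euc n) (ym : ℝ → Euc n) : Euc n :=
  -∫ σ in Ici (0:ℝ), ∫ τ in Ici σ, (Fl (zm τ + xm + ym τ) - Fl (zp τ + xm))

/-- the function `y_+`. -/
def yplusInt (Fl F : Euc n → Euc n) (zm zp : ℝ → Euc n) (xm : Euc n) (ym : ℝ → Euc n)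
    (t : ℝ) : Euc n :=
  ∫ σ in Ici t, ∫ τ in Ici σ, (F (zm τ + xm + ym τ) - Fl (zp τ))

/-- the vector `W(v_-,x_-)`. -/
def Wvec (Fl : Euc n → Euc n) (zm zp : ℝ → Euc n) (xm : Euc n) : Euc n :=
  (∫ σ in Iic (0:ℝ), ∫ τ in Iic σ, (Fl (zm τ + xm) - Fl (zm τ))) -
    ∫ σ in Ici (0:ℝ), ∫ τ in Ici σ, (Fl (zp τ + xm) - Fl (zp τ))

/-- the map `𝒢_{v_-,x_-}`; here `zm = z_-(v_-,x_-,·)` contains the base point `x_-`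
and `zp h = z_+(ã, x_- + h, ·)`. -/
def Gmap (Fl Fs F : Euc n → Euc n) (zm : ℝ → Euc n) (zp : Euc n → ℝ → Euc n)
    (ym : ℝ → Euc n) (h : Euc n) : Euc n :=
  lInt Fl Fs F zm 0 ym -
    ∫ σ in Ici (0:ℝ), ∫ τ in Ici σ, (Fl (zm τ + ym τ) - Fl (zp h τ))

/-- the vector `W̃(v_-,x_-)`; here `zp0 = z_+(ã, x_-, ·)`. -/
def Wtilde (Fl : Euc n → Euc n) (zm zp0 : ℝ → Euc n) : Euc n :=
  (∫ τ in Iic (0:ℝ), Fl (zm τ)) + ∫ τ in Ici (0:ℝ), Fl (zp0 τ)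

/-- The decaying weight `(1 + s|τ|)^(-p)`. -/
def wt (p s τ : ℝ) : ℝ := (1 + s * |τ|) ^ (-p)

/-- The weight `1 + max t 0` controlling the growth of elements of `M_r`. -/
def growth (t : ℝ) : ℝ := 1 + max t 0

/-- The total mass of `wt p 1`. -/
def mass (p : ℝ) : ℝ := ∫ τ, wt p 1 τ

lemma one_le_growth (t : ℝ) : 1 ≤ growth t := by
  simp [growth]

lemma growth_pos (t : ℝ) : 0 < growth t := by
  linarith [one_le_growth t]

lemma growth_le (t : ℝ) : growth t ≤ 1 + |t| := by
  have : max t 0 ≤ |t| := max_le (le_abs_self t) (abs_nonneg t)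
  unfold growth; linarith

lemma growth_of_nonpos {t : ℝ} (ht : t ≤ 0) : growth t = 1 := by
  simp [growth, ht]

lemma growth_of_nonneg {t : ℝ} (ht : 0 ≤ t) : growth t = 1 + t := by
  simp [growth, ht]

lemma continuous_growth : Continuous growth := by
  unfold growth; fun_prop

lemma wt_base_pos {s : ℝ} (hs : 0 ≤ s) (τ : ℝ) : 0 < 1 + s * |τ| := by positivity

lemma wt_nonneg {s : ℝ} (hs : 0 ≤ s) (p τ : ℝ) : 0 ≤ wt p s τ := by
  unfold wt; positivity

lemma wt_eq_comp (p : ℝ) {s : ℝ} (hs : 0 ≤ s) : wt p s = fun τ => wt p 1 (s * τ) := by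
  funext τ
  simp [wt, abs_mul, abs_of_nonneg hs]

lemma integrable_wt_one {p : ℝ} (hp : 1 < p) : Integrable (wt p 1) := by
  have h := integrable_one_add_norm (E := ℝ) (μ := volume) (r := p) (by simpa using hp)
  have e : wt p 1 = fun τ : ℝ => (1 + ‖τ‖) ^ (-p) := by
    funext τ
    simp [wt]
  rwa [e]

lemma integrable_wt {p s : ℝ} (hp : 1 < p) (hs : 0 < s) : Integrable (wt p s) := by
  rw [wt_eq_comp p hs.le]
  exact (integrable_wt_one hp).comp_mul_left' hs.ne'

lemma integral_wt (p : ℝ) {s : ℝ} (hs : 0 < s) : ∫ τ, wt p s τ = mass p / s := by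
  rw [wt_eq_comp p hs.le, Measure.integral_comp_mul_left (wt p 1) s, abs_of_pos (by positivity)]
  simp [mass]; ring

lemma mass_nonneg (p : ℝ) : 0 ≤ mass p :=
  integral_nonneg fun τ => wt_nonneg zero_le_one p τ

lemma wt_eq_mul {s : ℝ} (hs : 0 ≤ s) (p τ : ℝ) : wt p s τ = (1 + s * |τ|) * wt (p + 1) s τ := by
  have h := wt_base_pos hs τ
  unfold wt
  rw [show -p = 1 + -(p + 1) by ring, Real.rpow_add h, Real.rpow_one]

lemma wt_anti {s : ℝ} (hs : 0 ≤ s) (p τ : ℝ) : wt (p + 1) s τ ≤ wt p s τ := by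
  rw [wt_eq_mul hs p]
  have := wt_nonneg hs (p + 1) τ
  have : 0 ≤ s * |τ| := by positivity
  nlinarith

lemma abs_mul_wt_le {s : ℝ} (hs : 0 < s) (p τ : ℝ) : |τ| * wt (p + 1) s τ ≤ wt p s τ / s := by
  rw [wt_eq_mul hs.le p, le_div_iff₀ hs]
  have := wt_nonneg hs.le (p + 1) τ
  nlinarith

lemma one_add_abs_mul_wt_le {s : ℝ} (hs : 1 ≤ s) (p τ : ℝ) :
    (1 + |τ|) * wt (p + 1) s τ ≤ wt p s τ := by
  rw [wt_eq_mul (by linarith) p]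
  have := wt_nonneg (by linarith : 0 ≤ s) (p + 1) τ
  gcongr
  nlinarith [abs_nonneg τ]

lemma growth_mul_wt_le {s : ℝ} (hs : 1 ≤ s) (p τ : ℝ) : growth τ * wt (p + 1) s τ ≤ wt p s τ :=
  (mul_le_mul_of_nonneg_right (growth_le τ) (wt_nonneg (by linarith) _ _)).trans
    (one_add_abs_mul_wt_le hs p τ)

section Iterated

variable {E : Type*} [NormedAddCommGroup E] [NormedSpace ℝ E]

/-- Fubini for a kernel `1_P(σ, τ) g(τ)` whose `σ`-sections have finite measure. -/
lemma integrable_indicator_kernel {P : Set (ℝ × ℝ)} (hP : MeasurableSet P) {g : ℝ → E}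
    (hg : AEStronglyMeasurable g) (hfin : ∀ τ, volume {σ | (σ, τ) ∈ P} ≠ ⊤)
    (h_int : Integrable fun τ => volume.real {σ | (σ, τ) ∈ P} • g τ) :
    Integrable (P.indicator fun p : ℝ × ℝ => g p.2) (volume.prod volume) := by
  have hsec : ∀ τ, MeasurableSet {σ | (σ, τ) ∈ P} := fun τ => measurable_prodMk_right hP
  have hmeas : AEStronglyMeasurable (P.indicator fun p : ℝ × ℝ => g p.2) (volume.prod volume) :=
    (hg.comp_snd).indicator hP
  have hslice : ∀ τ : ℝ, (fun σ => P.indicator (fun p : ℝ × ℝ => g p.2) (σ, τ)) =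
      {σ | (σ, τ) ∈ P}.indicator fun _ => g τ := fun τ => by
    funext σ; simp [indicator]
  rw [integrable_prod_iff' hmeas]
  refine ⟨Eventually.of_forall fun τ => ?_, ?_⟩
  · rw [hslice]
    exact (integrable_indicator_iff (hsec τ)).2 (integrableOn_const (hfin τ))
  · convert h_int.norm using 2 with τ
    have : (fun σ => ‖P.indicator (fun p : ℝ × ℝ => g p.2) (σ, τ)‖) =
      {σ | (σ, τ) ∈ P}.indicator fun _ => ‖g τ‖ := by
      funext σ; simp [indicator]; split_ifs <;> simp
    rw [this, integral_indicator_const _ (hsec τ), norm_smul, smul_eq_mul,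
      Real.norm_of_nonneg measureReal_nonneg]

lemma integral_indicator_kernel [CompleteSpace E] {P : Set (ℝ × ℝ)} (hP : MeasurableSet P)
    {g : ℝ → E} (hg : AEStronglyMeasurable g) (hfin : ∀ τ, volume {σ | (σ, τ) ∈ P} ≠ ⊤)
    (h_int : Integrable fun τ => volume.real {σ | (σ, τ) ∈ P} • g τ) :
    ∫ σ, ∫ τ, P.indicator (fun p : ℝ × ℝ => g p.2) (σ, τ) =
      ∫ τ, volume.real {σ | (σ, τ) ∈ P} • g τ := by
  rw [integral_integral_swap (f := fun σ τ => P.indicator (fun p : ℝ × ℝ => g p.2) (σ, τ))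
    (integrable_indicator_kernel hP hg hfin h_int)]
  congr 1
  funext τ
  have : (fun σ => P.indicator (fun p : ℝ × ℝ => g p.2) (σ, τ)) =
      {σ | (σ, τ) ∈ P}.indicator fun _ => g τ := by
    funext σ; simp [indicator]
  have hsec : MeasurableSet {σ | (σ, τ) ∈ P} := measurable_prodMk_right hP
  rw [this, integral_indicator_const _ hsec]

lemma slice_Iic (t τ : ℝ) :
    {σ | (σ, τ) ∈ {p : ℝ × ℝ | p.2 ≤ p.1 ∧ p.1 ≤ t}} = Icc τ t := by
  ext; simp

lemma measurableSet_lower (t : ℝ) : MeasurableSet {p : ℝ × ℝ | p.2 ≤ p.1 ∧ p.1 ≤ t} :=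
  (measurableSet_le measurable_snd measurable_fst).inter
    (measurableSet_le measurable_fst measurable_const)

lemma volume_slice_smul_Iic (t : ℝ) (g : ℝ → E) :
    (fun τ => volume.real {σ | (σ, τ) ∈ {p : ℝ × ℝ | p.2 ≤ p.1 ∧ p.1 ≤ t}} • g τ) =
      (Iic t).indicator fun τ => (t - τ) • g τ := by
  funext τ
  rw [slice_Iic]
  by_cases h : τ ≤ t
  · simp [indicator, h]
  · simp [indicator, h]

lemma indicator_integral_Iic (t : ℝ) (g : ℝ → E) :
    (Iic t).indicator (fun σ => ∫ τ in Iic σ, g τ) = fun σ =>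
      ∫ τ, {p : ℝ × ℝ | p.2 ≤ p.1 ∧ p.1 ≤ t}.indicator (fun p : ℝ × ℝ => g p.2) (σ, τ) := by
  funext σ
  by_cases hσ : σ ≤ t
  · simp only [indicator, mem_Iic, hσ, if_true, mem_ofPred_eq, and_true]
    rw [← integral_indicator measurableSet_Iic]
    rfl
  · simp [indicator, hσ]

lemma integrableOn_integral_Iic {t : ℝ} {g : ℝ → E} (hg : AEStronglyMeasurable g)
    (h_int : IntegrableOn (fun τ => (t - τ) • g τ) (Iic t)) :
    IntegrableOn (fun σ => ∫ τ in Iic σ, g τ) (Iic t) := by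
  have h := (integrable_indicator_kernel (measurableSet_lower t) hg
    (fun τ => by rw [slice_Iic]; simp)
    (by rw [volume_slice_smul_Iic]; exact (integrable_indicator_iff measurableSet_Iic).2 h_int)
    ).integral_prod_left
  rwa [← integrable_indicator_iff measurableSet_Iic, indicator_integral_Iic]

/-- Iterated integrals over half-lines bounded above reduce to a single weighted integral. -/
lemma integral_integral_Iic [CompleteSpace E] {t : ℝ} {g : ℝ → E} (hg : AEStronglyMeasurable g)
    (h_int : IntegrableOn (fun τ => (t - τ) • g τ) (Iic t)) :
    ∫ σ in Iic t, ∫ τ in Iic σ, g τ = ∫ τ in Iic t, (t - τ) • g τ := by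
  have h := integral_indicator_kernel (measurableSet_lower t) hg
    (fun τ => by rw [slice_Iic]; simp)
    (by rw [volume_slice_smul_Iic]; exact (integrable_indicator_iff measurableSet_Iic).2 h_int)
  rw [volume_slice_smul_Iic, integral_indicator measurableSet_Iic] at h
  rw [← h, ← integral_indicator measurableSet_Iic, indicator_integral_Iic]

lemma integral_integral_Ici [CompleteSpace E] {g : ℝ → E} (hg : AEStronglyMeasurable g)
    (h_int : IntegrableOn (fun τ => τ • g τ) (Ioi 0)) :
    ∫ σ in Ici (0 : ℝ), ∫ τ in Ici σ, g τ = ∫ τ in Ioi (0 : ℝ), τ • g τ := by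
  have hneg : ∀ (c : ℝ) (f : ℝ → E), ∫ τ in Ici c, f τ = ∫ τ in Iic (-c), f (-τ) := by
    intro c f
    rw [integral_comp_neg_Iic, neg_neg, integral_Ici_eq_integral_Ioi]
  have hg' : AEStronglyMeasurable fun τ => g (-τ) :=
    hg.comp_quasiMeasurePreserving (Measure.measurePreserving_neg volume).quasiMeasurePreserving
  have h_int' : IntegrableOn (fun τ => ((0 : ℝ) - τ) • g (-τ)) (Iic 0) := by
    have : IntegrableOn (fun τ => τ • g τ) (Ici (-0)) := by
      rw [neg_zero, integrableOn_Ici_iff_integrableOn_Ioi]; exact h_int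
    simpa using this.comp_neg_Iic
  have h := integral_integral_Iic hg' h_int'
  rw [hneg 0, ← integral_Ici_eq_integral_Ioi, hneg 0]
  simp only [hneg _ g, neg_neg, neg_zero]
  rw [h]
  simp

lemma hasDerivAt_integral_Iic [CompleteSpace E] {f : ℝ → E} (hf : Continuous f)
    (h_int : ∀ t, IntegrableOn f (Iic t)) (t : ℝ) :
    HasDerivAt (fun t => ∫ τ in Iic t, f τ) (f t) t := by
  have h : (fun t => ∫ τ in Iic t, f τ) =
      fun t => (∫ τ in Iic 0, f τ) + ∫ τ in (0 : ℝ)..t, f τ := by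
    funext u
    rw [← intervalIntegral.integral_Iic_sub_Iic (h_int 0) (h_int u)]; abel
  rw [h]
  exact (hf.integral_hasStrictDerivAt 0 t).hasDerivAt.const_add _

end Iterated

section HalfLine

variable {E : Type*} [NormedAddCommGroup E] {p s M : ℝ} {g : ℝ → E}

lemma integrable_of_growth_bound (hp : 1 < p) (hs : 1 ≤ s) (hM : 0 ≤ M) (hg : Continuous g)
    (hb : ∀ τ, ‖g τ‖ ≤ M * (growth τ * wt (p + 1) s τ)) : Integrable g := by
  refine ((integrable_wt hp (by linarith : 0 < s)).const_mul M).mono' hg.aestronglyMeasurable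
    (Eventually.of_forall fun τ => (hb τ).trans ?_)
  exact mul_le_mul_of_nonneg_left (growth_mul_wt_le hs p τ) hM

variable [NormedSpace ℝ E]

lemma norm_sub_smul_le (hs : 1 ≤ s) (hM : 0 ≤ M)
    (hb : ∀ τ, ‖g τ‖ ≤ M * (growth τ * wt (p + 1) s τ)) {t τ : ℝ} (hτ : τ ≤ t) :
    ‖(t - τ) • g τ‖ ≤ M * (max t 0 + 1 / s) * wt p s τ := by
  have hs0 : 0 < s := by linarith
  have h1 := wt_nonneg hs0.le (p + 1) τ
  have h2 := wt_nonneg hs0.le p τ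
  rw [norm_smul, Real.norm_of_nonneg (by linarith)]
  have key : (t - τ) * (growth τ * wt (p + 1) s τ) ≤ (max t 0 + 1 / s) * wt p s τ := by
    rcases le_total τ 0 with h | h
    · rw [growth_of_nonpos h, one_mul]
      have h3 := abs_mul_wt_le hs0 p τ
      have h4 := wt_anti hs0.le p τ
      rw [abs_of_nonpos h] at h3
      have h5 : t * wt (p + 1) s τ ≤ max t 0 * wt p s τ :=
        mul_le_mul (le_max_left _ _) h4 h1 (le_max_right _ _)
      have h6 : 1 / s * wt p s τ = wt p s τ / s := by ring
      nlinarith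
    · have h3 := growth_mul_wt_le hs p τ
      have h4 : 0 ≤ growth τ * wt (p + 1) s τ := mul_nonneg (growth_pos τ).le h1
      have h5 : t - τ ≤ max t 0 + 1 / s := by
        have := le_max_left t 0
        have : 0 ≤ 1 / s := by positivity
        linarith
      exact mul_le_mul h5 h3 h4 (by positivity)
  calc (t - τ) * ‖g τ‖ ≤ (t - τ) * (M * (growth τ * wt (p + 1) s τ)) :=
        mul_le_mul_of_nonneg_left (hb τ) (by linarith)
    _ = M * ((t - τ) * (growth τ * wt (p + 1) s τ)) := by ring
    _ ≤ M * ((max t 0 + 1 / s) * wt p s τ) := mul_le_mul_of_nonneg_left key hM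
    _ = _ := by ring

lemma integrableOn_sub_smul (hp : 1 < p) (hs : 1 ≤ s) (hM : 0 ≤ M) (hg : Continuous g)
    (hb : ∀ τ, ‖g τ‖ ≤ M * (growth τ * wt (p + 1) s τ)) (t : ℝ) :
    IntegrableOn (fun τ => (t - τ) • g τ) (Iic t) := by
  refine Integrable.mono' (g := fun τ => M * (max t 0 + 1 / s) * wt p s τ)
    (((integrable_wt hp (by linarith : 0 < s)).const_mul _).integrableOn)
    (by fun_prop) ?_
  exact (ae_restrict_mem measurableSet_Iic).mono fun τ hτ => norm_sub_smul_le hs hM hb hτ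

lemma integral_integral_Iic_sub {M' : ℝ} {g' : ℝ → E} (hp : 1 < p) (hs : 1 ≤ s) (hM : 0 ≤ M)
    (hg : Continuous g) (hb : ∀ τ, ‖g τ‖ ≤ M * (growth τ * wt (p + 1) s τ)) (hM' : 0 ≤ M')
    (hg' : Continuous g') (hb' : ∀ τ, ‖g' τ‖ ≤ M' * (growth τ * wt (p + 1) s τ)) (t : ℝ) :
    (∫ σ in Iic t, ∫ τ in Iic σ, g τ) - (∫ σ in Iic t, ∫ τ in Iic σ, g' τ) =
      ∫ σ in Iic t, ∫ τ in Iic σ, (g τ - g' τ) := by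
  have h1 := integrableOn_integral_Iic hg.aestronglyMeasurable
    (integrableOn_sub_smul hp hs hM hg hb t)
  have h2 := integrableOn_integral_Iic hg'.aestronglyMeasurable
    (integrableOn_sub_smul hp hs hM' hg' hb' t)
  rw [← integral_sub h1 h2]
  congr 1
  funext σ
  rw [integral_sub (integrable_of_growth_bound hp hs hM hg hb).integrableOn
    (integrable_of_growth_bound hp hs hM' hg' hb').integrableOn]

variable [CompleteSpace E]

lemma norm_integral_integral_Iic_le (hp : 1 < p) (hs : 1 ≤ s) (hM : 0 ≤ M) (hg : Continuous g)
    (hb : ∀ τ, ‖g τ‖ ≤ M * (growth τ * wt (p + 1) s τ)) (t : ℝ) :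
    ‖∫ σ in Iic t, ∫ τ in Iic σ, g τ‖ ≤ M * (max t 0 + 1 / s) * (mass p / s) := by
  have hs0 : 0 < s := by linarith
  have hC : 0 ≤ M * (max t 0 + 1 / s) := by positivity
  rw [integral_integral_Iic hg.aestronglyMeasurable (integrableOn_sub_smul hp hs hM hg hb t),
    ← integral_wt p hs0, ← integral_const_mul]
  refine (norm_integral_le_of_norm_le ((integrable_wt hp hs0).const_mul _).integrableOn
    ((ae_restrict_mem measurableSet_Iic).mono fun τ hτ => norm_sub_smul_le hs hM hb hτ)).trans ?_
  exact setIntegral_le_integral ((integrable_wt hp hs0).const_mul _)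
    (Eventually.of_forall fun τ => mul_nonneg hC (wt_nonneg hs0.le p τ))

lemma norm_integral_integral_Iic_le_growth (hp : 1 < p) (hs : 1 ≤ s) (hM : 0 ≤ M)
    (hg : Continuous g) (hb : ∀ τ, ‖g τ‖ ≤ M * (growth τ * wt (p + 1) s τ)) (t : ℝ) :
    ‖∫ σ in Iic t, ∫ τ in Iic σ, g τ‖ ≤ M * mass p / s * growth t := by
  refine (norm_integral_integral_Iic_le hp hs hM hg hb t).trans ?_
  have h0 := mass_nonneg p
  have h1 : 1 / s ≤ 1 := by rw [div_le_one (by linarith)]; exact hs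
  have h2 : 0 ≤ mass p / s := by positivity
  calc M * (max t 0 + 1 / s) * (mass p / s) ≤ M * (max t 0 + 1) * (mass p / s) := by gcongr
    _ = _ := by unfold growth; ring

lemma hasDerivAt_integral_integral_Iic (hp : 1 < p) (hs : 1 ≤ s) (hM : 0 ≤ M) (hg : Continuous g)
    (hb : ∀ τ, ‖g τ‖ ≤ M * (growth τ * wt (p + 1) s τ)) (t : ℝ) :
    HasDerivAt (fun t => ∫ σ in Iic t, ∫ τ in Iic σ, g τ) (∫ τ in Iic t, g τ) t := by
  refine hasDerivAt_integral_Iic ?_ (fun t => integrableOn_integral_Iic hg.aestronglyMeasurable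
    (integrableOn_sub_smul hp hs hM hg hb t)) t
  have hi := integrable_of_growth_bound hp hs hM hg hb
  exact continuous_iff_continuousAt.2 fun u =>
    (hasDerivAt_integral_Iic hg (fun t => hi.integrableOn) u).continuousAt

end HalfLine

section FixedPoint

variable {E : Type*} [NormedAddCommGroup E] {T : (ℝ → E) → ℝ → E}

/-- Continuous functions dominated by `growth`. -/
def Dominated (f : ℝ → E) : Prop := Continuous f ∧ ∀ t, ‖f t‖ ≤ growth t

/-- `T` contracts distances by `1/2` in the norm weighted by `growth`. -/
def HalfContracting (T : (ℝ → E) → ℝ → E) : Prop :=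
  ∀ f g, Dominated f → Dominated g → ∀ d, 0 ≤ d → (∀ t, ‖f t - g t‖ ≤ d * growth t) →
    ∀ t, ‖T f t - T g t‖ ≤ d / 2 * growth t

lemma HalfContracting.fixedPoint_unique (hT : HalfContracting T) {f g : ℝ → E}
    (hf : Dominated f) (hg : Dominated g) (hTf : T f = f) (hTg : T g = g) : f = g := by
  have key : ∀ (k : ℕ) (t : ℝ), ‖f t - g t‖ ≤ 2 * (1 / 2) ^ k * growth t := by
    intro k
    induction k with
    | zero => intro t; have := norm_sub_le (f t) (g t); linarith [hf.2 t, hg.2 t]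
    | succ k ih =>
      intro t
      have := hT f g hf hg _ (by positivity) ih t
      rw [hTf, hTg] at this
      refine this.trans (le_of_eq ?_)
      ring
  funext t
  have hlim : Tendsto (fun k : ℕ => 2 * (1 / 2 : ℝ) ^ k * growth t) atTop (𝓝 (2 * 0 * growth t)) :=
    ((tendsto_pow_atTop_nhds_zero_of_lt_one (by norm_num) (by norm_num)).const_mul 2).mul_const _
  have h0 := ge_of_tendsto' hlim fun k => key k t
  simp only [mul_zero, zero_mul] at h0
  exact sub_eq_zero.1 (norm_le_zero_iff.1 h0)

variable [NormedSpace ℝ E] [CompleteSpace E]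

lemma HalfContracting.exists_fixedPoint (hT : HalfContracting T)
    (hmap : ∀ f, Dominated f → Dominated (T f)) : ∃ f, Dominated f ∧ T f = f := by
  let X := Metric.closedBall (0 : BoundedContinuousFunction ℝ E) 1
  have hX : ∀ h : X, ∀ t, ‖h.1 t‖ ≤ 1 := fun h t =>
    (h.1.norm_coe_le_norm t).trans (mem_closedBall_zero_iff.1 h.2)
  have hdom : ∀ h : X, Dominated fun t => growth t • h.1 t := fun h =>
    ⟨continuous_growth.smul h.1.continuous, fun t => by
      rw [norm_smul, Real.norm_of_nonneg (growth_pos t).le]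
      have := growth_pos t
      nlinarith [hX h t]⟩
  have hcont : ∀ h : X, Continuous fun t => (growth t)⁻¹ • T (fun t => growth t • h.1 t) t :=
    fun h => (continuous_growth.inv₀ fun t => (growth_pos t).ne').smul (hmap _ (hdom h)).1
  have hbd : ∀ (h : X) t, ‖(growth t)⁻¹ • T (fun t => growth t • h.1 t) t‖ ≤ 1 := fun h t => by
    rw [norm_smul, norm_inv, Real.norm_of_nonneg (growth_pos t).le,
      inv_mul_le_iff₀ (growth_pos t), mul_one]
    exact (hmap _ (hdom h)).2 t
  let T' : X → X := fun h =>
    ⟨BoundedContinuousFunction.ofNormedAddCommGroup _ (hcont h) 1 (hbd h), by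
      rw [mem_closedBall_zero_iff]
      exact BoundedContinuousFunction.norm_ofNormedAddCommGroup_le _ zero_le_one _⟩
  have hcontr : ContractingWith (1 / 2) T' := by
    refine ⟨by rw [← NNReal.coe_lt_coe]; norm_num, LipschitzWith.of_dist_le_mul fun h k => ?_⟩
    rw [Subtype.dist_eq, Subtype.dist_eq, BoundedContinuousFunction.dist_le (by positivity)]
    intro t
    have := hT _ _ (hdom h) (hdom k) (dist h.1 k.1) dist_nonneg (fun t => by
      rw [← smul_sub, norm_smul, Real.norm_of_nonneg (growth_pos t).le, mul_comm, ← dist_eq_norm]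
      exact mul_le_mul_of_nonneg_right (BoundedContinuousFunction.dist_coe_le_dist t)
        (growth_pos t).le) t
    change dist ((growth t)⁻¹ • T (fun t => growth t • h.1 t) t)
      ((growth t)⁻¹ • T (fun t => growth t • k.1 t) t) ≤ _
    rw [dist_eq_norm, ← smul_sub, norm_smul, norm_inv, Real.norm_of_nonneg (growth_pos t).le,
      inv_mul_le_iff₀ (growth_pos t)]
    refine this.trans (le_of_eq ?_)
    push_cast
    ring
  have : CompleteSpace X := Metric.isClosed_closedBall.completeSpace_coe
  have : Nonempty X := ⟨⟨0, by simp [X]⟩⟩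
  let h := ContractingWith.fixedPoint T' hcontr
  have hh : T' h = h := hcontr.fixedPoint_isFixedPt
  refine ⟨fun t => growth t • h.1 t, hdom h, ?_⟩
  funext t
  have ht : (growth t)⁻¹ • T (fun t => growth t • h.1 t) t = h.1 t :=
    congrArg (fun k : X => k.1 t) hh
  rw [← ht, smul_inv_smul₀ (growth_pos t).ne']

end FixedPoint

lemma MemM.norm_le {n : ℕ} {r : ℝ} {f : ℝ → Euc n} (h : MemM r f) (t : ℝ) :
    ‖f t‖ ≤ r * growth t := by
  obtain ⟨-, h1, h2, h3⟩ := h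
  have n1 : 0 ≤ sSup ((fun t => ‖f t‖) '' Iic 0) := by
    refine Real.sSup_nonneg ?_
    rintro _ ⟨t, -, rfl⟩
    exact norm_nonneg _
  have n2 : 0 ≤ sSup ((fun t => ‖f t‖ / (1 + t)) '' Ici 0) := by
    refine Real.sSup_nonneg ?_
    rintro _ ⟨t, ht, rfl⟩
    have : 0 ≤ t := ht
    positivity
  unfold Mnorm at h3
  rcases le_total t 0 with ht | ht
  · rw [growth_of_nonpos ht]
    have := le_csSup h1 ⟨t, ht, rfl⟩
    simp only at this
    linarith
  · rw [growth_of_nonneg ht, ← div_le_iff₀ (by linarith)]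
    have := le_csSup h2 ⟨t, ht, rfl⟩
    simp only at this
    linarith

lemma memM_of_norm_le {n : ℕ} {r : ℝ} {f : ℝ → Euc n} (hf : Continuous f)
    (h : ∀ t, ‖f t‖ ≤ r / 2 * growth t) : MemM r f := by
  have h1 : ∀ y ∈ (fun t => ‖f t‖) '' Iic 0, y ≤ r / 2 := by
    rintro _ ⟨t, ht, rfl⟩
    simpa [growth_of_nonpos ht] using h t
  have h2 : ∀ y ∈ (fun t => ‖f t‖ / (1 + t)) '' Ici 0, y ≤ r / 2 := by
    rintro _ ⟨t, ht, rfl⟩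
    have ht' : 0 ≤ t := ht
    simp only
    rw [div_le_iff₀ (by linarith), ← growth_of_nonneg ht']
    exact h t
  refine ⟨hf, ⟨_, h1⟩, ⟨_, h2⟩, ?_⟩
  have e1 := csSup_le (nonempty_Iic.image _) h1
  have e2 := csSup_le (nonempty_Ici.image _) h2
  unfold Mnorm
  linarith

section Potential

variable {E : Type*} [NormedAddCommGroup E] [InnerProductSpace ℝ E]

lemma le_one_add_norm_of_mem_tube {θ : E} (hθ : ‖θ‖ = 1) {B s τ : ℝ} (hB : 0 ≤ B) (hs : 2 * B ≤ s)
    {a : E} (ha : a ∈ Metric.closedBall ((s * τ) • θ) (B * (1 + |τ|))) :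
    (2 * (1 + B))⁻¹ * (1 + s * |τ|) ≤ 1 + ‖a‖ := by
  rw [inv_mul_le_iff₀ (by positivity)]
  have h1 : ‖(s * τ) • θ‖ = s * |τ| := by
    rw [norm_smul, hθ, mul_one, Real.norm_eq_abs, abs_mul, abs_of_nonneg (by linarith)]
  have h2 : ‖(s * τ) • θ‖ ≤ ‖a‖ + B * (1 + |τ|) := by
    have := norm_sub_norm_le ((s * τ) • θ) a
    rw [mem_closedBall_iff_norm'] at ha
    linarith
  rw [h1] at h2
  have h3 : 0 ≤ B * ‖a‖ := by positivity
  have h4 : 2 * B * |τ| ≤ s * |τ| := by gcongr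
  nlinarith

variable [CompleteSpace E]

lemma continuous_gradient {V : E → ℝ} (hV : ContDiff ℝ 2 V) : Continuous (gradient V) :=
  (InnerProductSpace.toDual ℝ E).symm.continuous.comp (hV.continuous_fderiv (by norm_num))

lemma norm_gradient_sub_le {V : E → ℝ} (hV : ContDiff ℝ 2 V) {β q M : ℝ} (hβ : 0 ≤ β)
    (hq : 0 ≤ q) (h2 : ∀ x, ‖iteratedFDeriv ℝ 2 V x‖ ≤ β * (1 + ‖x‖) ^ (-q)) (hM : 0 < M)
    {a b : E} (hseg : ∀ y ∈ segment ℝ a b, M ≤ 1 + ‖y‖) :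
    ‖gradient V a - gradient V b‖ ≤ β * M ^ (-q) * ‖a - b‖ := by
  have hd : Differentiable ℝ (fderiv ℝ V) :=
    (hV.fderiv_right (m := 1) (by norm_num)).differentiable (by norm_num)
  have hbound : ∀ y ∈ segment ℝ a b, ‖fderiv ℝ (fderiv ℝ V) y‖ ≤ β * M ^ (-q) := fun y hy => by
    have e : ‖fderiv ℝ (fderiv ℝ V) y‖ = ‖iteratedFDeriv ℝ 2 V y‖ := by
      rw [← norm_iteratedFDeriv_one, norm_iteratedFDeriv_fderiv]
    rw [e]
    refine (h2 y).trans (mul_le_mul_of_nonneg_left ?_ hβ)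
    exact Real.rpow_le_rpow_of_nonpos hM (hseg y hy) (by linarith)
  have := (convex_segment a b).norm_image_sub_le_of_norm_fderiv_le (𝕜 := ℝ)
    (fun y _ => hd y) hbound (right_mem_segment ℝ a b) (left_mem_segment ℝ a b)
  rwa [show gradient V a - gradient V b =
    (InnerProductSpace.toDual ℝ E).symm (fderiv ℝ V a - fderiv ℝ V b) by
      rw [map_sub]; rfl, LinearIsometryEquiv.norm_map]

/-- Decay and Lipschitz bounds for the force fields on the tubes around `t ↦ s t θ`. -/
structure TubeBound (p s K B : ℝ) (θ : E) (Fl Fs : E → E) : Prop where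
  long : ∀ τ, ∀ a ∈ Metric.closedBall ((s * τ) • θ) (B * (1 + |τ|)), ‖Fl a‖ ≤ K * wt p s τ
  short : ∀ τ, ∀ a ∈ Metric.closedBall ((s * τ) • θ) (B * (1 + |τ|)),
    ‖Fs a‖ ≤ K * wt (p + 1) s τ
  long_sub : ∀ τ, ∀ a ∈ Metric.closedBall ((s * τ) • θ) (B * (1 + |τ|)),
    ∀ b ∈ Metric.closedBall ((s * τ) • θ) (B * (1 + |τ|)),
    ‖Fl a - Fl b‖ ≤ K * wt (p + 1) s τ * ‖a - b‖
  short_sub : ∀ τ, ∀ a ∈ Metric.closedBall ((s * τ) • θ) (B * (1 + |τ|)),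
    ∀ b ∈ Metric.closedBall ((s * τ) • θ) (B * (1 + |τ|)),
    ‖Fs a - Fs b‖ ≤ K * wt (p + 1) s τ * ‖a - b‖

lemma exists_tubeBound {Vl Vs : E → ℝ} {α β₁ β₂ γ₁ γ₂ B : ℝ} {θ : E} (hθ : ‖θ‖ = 1) (hB : 0 ≤ B)
    (hα : 0 ≤ α) (hβ₁ : 0 ≤ β₁) (hβ₂ : 0 ≤ β₂) (hγ₁ : 0 ≤ γ₁) (hγ₂ : 0 ≤ γ₂)
    (hVl : ContDiff ℝ 2 Vl) (hVs : ContDiff ℝ 2 Vs)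
    (hl₁ : ∀ x, ‖gradient Vl x‖ ≤ β₁ * (1 + ‖x‖) ^ (-(α + 1)))
    (hl₂ : ∀ x, ‖iteratedFDeriv ℝ 2 Vl x‖ ≤ β₂ * (1 + ‖x‖) ^ (-(α + 2)))
    (hs₁ : ∀ x, ‖gradient Vs x‖ ≤ γ₁ * (1 + ‖x‖) ^ (-(α + 2)))
    (hs₂ : ∀ x, ‖iteratedFDeriv ℝ 2 Vs x‖ ≤ γ₂ * (1 + ‖x‖) ^ (-(α + 3)))
    {Fl Fs : E → E} (hFl : ∀ y, Fl y = -gradient Vl y) (hFs : ∀ y, Fs y = -gradient Vs y) :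
    ∃ K, 0 ≤ K ∧ ∀ s, 2 * B ≤ s → TubeBound (α + 1) s K B θ Fl Fs := by
  set c : ℝ := (2 * (1 + B))⁻¹ with hc
  have hc0 : 0 < c := by positivity
  have hscale : ∀ (q s τ : ℝ), 0 ≤ s → (c * (1 + s * |τ|)) ^ (-q) = c ^ (-q) * wt q s τ :=
    fun q s τ hs => Real.mul_rpow hc0.le (wt_base_pos hs τ).le
  have hpt : ∀ {β q s τ : ℝ} {a : E}, 0 ≤ β → 0 ≤ q → 2 * B ≤ s →
      a ∈ Metric.closedBall ((s * τ) • θ) (B * (1 + |τ|)) →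
      β * (1 + ‖a‖) ^ (-q) ≤ β * c ^ (-q) * wt q s τ := by
    intro β q s τ a hβ hq hs ha
    rw [mul_assoc, ← hscale q s τ (by linarith)]
    have hs0 : 0 ≤ s := by linarith
    exact mul_le_mul_of_nonneg_left (Real.rpow_le_rpow_of_nonpos (by positivity)
      (le_one_add_norm_of_mem_tube hθ hB hs ha) (by linarith)) hβ
  have hsub : ∀ {V : E → ℝ} {β q s τ : ℝ} {a b : E}, ContDiff ℝ 2 V → 0 ≤ β → 0 ≤ q → 2 * B ≤ s →
      (∀ x, ‖iteratedFDeriv ℝ 2 V x‖ ≤ β * (1 + ‖x‖) ^ (-q)) →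
      a ∈ Metric.closedBall ((s * τ) • θ) (B * (1 + |τ|)) →
      b ∈ Metric.closedBall ((s * τ) • θ) (B * (1 + |τ|)) →
      ‖gradient V a - gradient V b‖ ≤ β * c ^ (-q) * wt q s τ * ‖a - b‖ := by
    intro V β q s τ a b hV hβ hq hs h2 ha hb
    have hs0 : 0 ≤ s := by linarith
    rw [mul_assoc β, ← hscale q s τ hs0]
    exact norm_gradient_sub_le hV hβ hq h2 (by positivity) fun y hy =>
      le_one_add_norm_of_mem_tube hθ hB hs ((convex_closedBall _ _).segment_subset ha hb hy)
  have e2 : α + 1 + 1 = α + 2 := by ring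
  refine ⟨β₁ * c ^ (-(α + 1)) + β₂ * c ^ (-(α + 2)) + γ₁ * c ^ (-(α + 2)) +
    γ₂ * c ^ (-(α + 3)), by positivity, fun s hs => ?_⟩
  have hs0 : 0 ≤ s := by linarith
  have k1 : 0 ≤ β₁ * c ^ (-(α + 1)) := by positivity
  have k2 : 0 ≤ β₂ * c ^ (-(α + 2)) := by positivity
  have k3 : 0 ≤ γ₁ * c ^ (-(α + 2)) := by positivity
  have k4 : 0 ≤ γ₂ * c ^ (-(α + 3)) := by positivity
  refine ⟨fun τ a ha => ?_, fun τ a ha => ?_, fun τ a ha b hb => ?_, fun τ a ha b hb => ?_⟩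
  · rw [hFl, norm_neg]
    refine ((hl₁ a).trans (hpt hβ₁ (by linarith) hs ha)).trans ?_
    exact mul_le_mul_of_nonneg_right (by linarith) (wt_nonneg hs0 _ _)
  · rw [hFs, norm_neg, e2]
    refine ((hs₁ a).trans (hpt hγ₁ (by linarith) hs ha)).trans ?_
    exact mul_le_mul_of_nonneg_right (by linarith) (wt_nonneg hs0 _ _)
  · rw [hFl, hFl, neg_sub_neg, norm_sub_rev, e2]
    refine (hsub hVl hβ₂ (by linarith) hs hl₂ ha hb).trans ?_
    gcongr
    · exact wt_nonneg hs0 _ _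
    · linarith
  · rw [hFs, hFs, neg_sub_neg, norm_sub_rev]
    refine (hsub hVs hγ₂ (by linarith) hs hs₂ ha hb).trans ?_
    have := wt_anti hs0 (α + 2) τ
    rw [show α + 2 + 1 = α + 3 by ring] at this
    rw [e2]
    gcongr
    · exact wt_nonneg hs0 _ _
    · linarith

end Potential

section Backward

variable {E : Type*} [NormedAddCommGroup E] [NormedSpace ℝ E] [CompleteSpace E]
  {δ D h : ℝ → E} {p s K c : ℝ}

lemma norm_le_of_linear_bound (hp : 1 < p) (hs : 0 < s) (hK : 0 ≤ K) (hc : 0 ≤ c)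
    (hδ : ∀ t, HasDerivAt δ (D t) t) (hD : ∀ t, HasDerivAt D (h t) t) (hh : Continuous h)
    (hlim : Tendsto D atTop (𝓝 0))
    (hb : ∀ τ, 0 ≤ τ → ‖h τ‖ ≤ K * wt (p + 1) s τ * (c + ‖δ τ‖))
    {A ε : ℝ} (hA : 0 ≤ A) (hε : 0 ≤ ε) (hlin : ∀ t, 0 ≤ t → ‖δ t‖ ≤ A * (1 + ε * t))
    {t : ℝ} (ht : 0 ≤ t) :
    ‖δ t‖ ≤ ‖δ 0‖ + K * mass p / s ^ 2 * (c + A * (1 + ε * t)) := by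
  have hh' : ∀ τ, 0 ≤ τ → ‖h τ‖ ≤ K * wt (p + 1) s τ * (c + A * (1 + ε * τ)) := fun τ hτ =>
    (hb τ hτ).trans (by
      have := wt_nonneg hs.le (p + 1) τ
      have := hlin τ hτ
      gcongr)
  set W : ℝ → ℝ := fun τ => (c + A * (1 + ε * t)) * (K / s) * wt p s τ with hW
  have hWi : Integrable W := (integrable_wt hp hs).const_mul _
  have hW0 : ∀ τ, 0 ≤ W τ := fun τ => by
    have := wt_nonneg hs.le p τ
    positivity
  have hτW : ∀ τ, 0 ≤ τ → τ * (K * wt (p + 1) s τ) * (c + A * (1 + ε * t)) ≤ W τ := fun τ hτ => by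
    have h1 := abs_mul_wt_le hs p τ
    rw [abs_of_nonneg hτ] at h1
    calc τ * (K * wt (p + 1) s τ) * (c + A * (1 + ε * t))
        = (c + A * (1 + ε * t)) * K * (τ * wt (p + 1) s τ) := by ring
      _ ≤ (c + A * (1 + ε * t)) * K * (wt p s τ / s) := by gcongr
      _ = W τ := by rw [hW]; ring
  have hhi : IntegrableOn h (Ioi t) := by
    refine Integrable.mono' (g := fun τ => (c + A * (1 + ε)) * (K * (1 + s⁻¹)) * wt p s τ)
      ((integrable_wt hp hs).const_mul _).integrableOn hh.aestronglyMeasurable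
      ((ae_restrict_mem measurableSet_Ioi).mono fun τ hτ => ?_)
    have hτ0 : 0 ≤ τ := ht.trans (le_of_lt hτ)
    have h1 := abs_mul_wt_le hs p τ
    rw [abs_of_nonneg hτ0] at h1
    have h2 := wt_anti hs.le p τ
    have h3 := wt_nonneg hs.le (p + 1) τ
    calc ‖h τ‖ ≤ K * wt (p + 1) s τ * (c + A * (1 + ε * τ)) := hh' τ hτ0
      _ ≤ K * wt (p + 1) s τ * ((c + A * (1 + ε)) * (1 + τ)) := by
        gcongr
        have : 0 ≤ c * τ := by positivity
        have : 0 ≤ A * τ := by positivity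
        have : 0 ≤ A * ε := by positivity
        nlinarith
      _ = (c + A * (1 + ε)) * K * (wt (p + 1) s τ + τ * wt (p + 1) s τ) := by ring
      _ ≤ (c + A * (1 + ε)) * K * (wt p s τ + wt p s τ / s) := by gcongr
      _ = _ := by ring
  have hDt : ∫ τ in Ioi t, h τ = -D t := by
    rw [integral_Ioi_of_hasDerivAt_of_tendsto (hD t).continuousAt.continuousWithinAt
      (fun τ _ => hD τ) hhi hlim, zero_sub]
  have hparts : ∫ τ in (0 : ℝ)..t, τ • h τ = t • D t - δ t + δ 0 := by
    rw [intervalIntegral.integral_eq_sub_of_hasDerivAt (f := fun τ => τ • D τ - δ τ)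
      (fun τ _ => (((hasDerivAt_id τ).smul (hD τ)).sub (hδ τ)).congr_deriv (by simp))
      (Continuous.intervalIntegrable (by fun_prop) _ _)]
    simp
  have hsum : δ t - δ 0 = -(∫ τ in Ioi t, t • h τ) - ∫ τ in Ioc 0 t, τ • h τ := by
    rw [integral_smul, hDt, ← intervalIntegral.integral_of_le ht, hparts]
    simp only [smul_neg]
    abel
  have b1 : ‖∫ τ in Ioi t, t • h τ‖ ≤ ∫ τ in Ioi t, W τ := by
    refine norm_integral_le_of_norm_le hWi.integrableOn
      ((ae_restrict_mem measurableSet_Ioi).mono fun τ hτ => ?_)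
    have hτ' : t ≤ τ := le_of_lt hτ
    have hτ0 : 0 ≤ τ := ht.trans hτ'
    have h3 := wt_nonneg hs.le (p + 1) τ
    refine le_trans ?_ (hτW τ hτ0)
    rw [norm_smul, Real.norm_of_nonneg ht]
    calc t * ‖h τ‖ ≤ t * (K * wt (p + 1) s τ * (c + A * (1 + ε * τ))) :=
          mul_le_mul_of_nonneg_left (hh' τ hτ0) ht
      _ = K * wt (p + 1) s τ * (t * (c + A) + A * ε * (t * τ)) := by ring
      _ ≤ K * wt (p + 1) s τ * (τ * (c + A) + A * ε * (t * τ)) := by gcongr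
      _ = _ := by ring
  have b2 : ‖∫ τ in Ioc 0 t, τ • h τ‖ ≤ ∫ τ in Ioc 0 t, W τ := by
    refine norm_integral_le_of_norm_le hWi.integrableOn
      ((ae_restrict_mem measurableSet_Ioc).mono fun τ hτ => ?_)
    have hτ' : τ ≤ t := hτ.2
    have hτ0 : 0 ≤ τ := hτ.1.le
    have h3 := wt_nonneg hs.le (p + 1) τ
    refine le_trans ?_ (hτW τ hτ0)
    rw [norm_smul, Real.norm_of_nonneg hτ0, mul_assoc]
    refine mul_le_mul_of_nonneg_left ((hh' τ hτ0).trans ?_) hτ0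
    gcongr
  have b3 : (∫ τ in Ioi t, W τ) + ∫ τ in Ioc 0 t, W τ ≤
      K * mass p / s ^ 2 * (c + A * (1 + ε * t)) := by
    rw [add_comm, ← setIntegral_union (Ioc_disjoint_Ioi le_rfl) measurableSet_Ioi
      hWi.integrableOn hWi.integrableOn]
    refine (setIntegral_le_integral hWi (Eventually.of_forall hW0)).trans (le_of_eq ?_)
    rw [hW, integral_const_mul, integral_wt p hs]
    field_simp
  have b4 : ‖δ t - δ 0‖ ≤ K * mass p / s ^ 2 * (c + A * (1 + ε * t)) := by
    rw [hsum]
    refine (norm_sub_le _ _).trans ?_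
    rw [norm_neg]
    linarith
  have := norm_sub_norm_le (δ t) (δ 0)
  linarith

/-- A solution of a linear differential inequality with decaying coefficients, at most linearly
growing and with vanishing velocity at infinity, is bounded. -/
lemma norm_le_of_second_order (hp : 1 < p) (hs : 0 < s) (hK : 0 ≤ K) (hc : 0 ≤ c)
    (hδ : ∀ t, HasDerivAt δ (D t) t) (hD : ∀ t, HasDerivAt D (h t) t) (hh : Continuous h)
    (hlim : Tendsto D atTop (𝓝 0))
    (hb : ∀ τ, 0 ≤ τ → ‖h τ‖ ≤ K * wt (p + 1) s τ * (c + ‖δ τ‖))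
    {N : ℝ} (hN : 0 ≤ N) (hlin : ∀ t, 0 ≤ t → ‖δ t‖ ≤ N * (1 + t))
    (hsmall : K * mass p / s ^ 2 ≤ 1 / 2) {t : ℝ} (ht : 0 ≤ t) :
    ‖δ t‖ ≤ 2 * (‖δ 0‖ + K * mass p / s ^ 2 * c) := by
  set η := K * mass p / s ^ 2 with hη
  have hη0 : 0 ≤ η := by
    have := mass_nonneg p
    positivity
  set m := ‖δ 0‖ + η * c with hm
  have hm0 : 0 ≤ m := by positivity
  have hε : ∀ ε, 0 < ε → ε ≤ 1 → ‖δ t‖ ≤ 2 * m * (1 + ε * t) := by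
    intro ε hε0 hε1
    have key : ∀ (k : ℕ) (u : ℝ), 0 ≤ u → ‖δ u‖ ≤ (2 * m + N / ε * (1 / 2) ^ k) * (1 + ε * u) := by
      intro k
      induction k with
      | zero =>
        intro u hu
        have h1 : N * (1 + u) ≤ N / ε * (1 + ε * u) := by
          have : N ≤ N / ε := by rw [le_div_iff₀ hε0]; nlinarith
          calc N * (1 + u) = N + N * u := by ring
            _ ≤ N / ε + N * u := by linarith
            _ = N / ε * (1 + ε * u) := by field_simp
        have h2 : 0 ≤ 2 * m * (1 + ε * u) := by positivity
        have := hlin u hu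
        simp only [pow_zero, mul_one]
        nlinarith
      | succ k ih =>
        intro u hu
        have h1 := norm_le_of_linear_bound hp hs hK hc hδ hD hh hlim hb
          (A := 2 * m + N / ε * (1 / 2) ^ k) (by positivity) hε0.le ih hu
        rw [← hη] at h1
        have h2 : 0 ≤ (2 * m + N / ε * (1 / 2) ^ k) * (1 + ε * u) := by positivity
        have h3 := mul_le_mul_of_nonneg_right hsmall h2
        have h4 : 0 ≤ m * (ε * u) := by positivity
        rw [pow_succ]
        nlinarith
    have hl : Tendsto (fun k : ℕ => (2 * m + N / ε * (1 / 2 : ℝ) ^ k) * (1 + ε * t)) atTop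
        (𝓝 ((2 * m + N / ε * 0) * (1 + ε * t))) :=
      (((tendsto_pow_atTop_nhds_zero_of_lt_one (by norm_num) (by norm_num)).const_mul _).const_add
        _).mul_const _
    have := ge_of_tendsto' hl fun k => key k t ht
    simpa using this
  have hl : Tendsto (fun ε : ℝ => 2 * m * (1 + ε * t)) (𝓝[>] 0) (𝓝 (2 * m * (1 + 0 * t))) := by
    refine Tendsto.mono_left ?_ nhdsWithin_le_nhds
    exact Continuous.tendsto (by fun_prop) 0
  have hev : ∀ᶠ ε : ℝ in 𝓝[>] 0, ‖δ t‖ ≤ 2 * m * (1 + ε * t) := by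
    filter_upwards [Ioc_mem_nhdsGT (zero_lt_one' ℝ)] with ε hε'
    exact hε ε hε'.1 hε'.2
  simpa using ge_of_tendsto hl hev

end Backward

/-- The fields `Fl`, `Fs`, `F = Fl + Fs` are controlled along the tube around `t ↦ s t θ`, and `z`
is a nearly straight trajectory. -/
structure Setting (p s K : ℝ) (θ x : Euc n) (Fl Fs F : Euc n → Euc n) (z : ℝ → Euc n) : Prop where
  one_lt : 1 < p
  one_le : 1 ≤ s
  nonneg : 0 ≤ K
  tube : TubeBound p s K (‖x‖ + 3) θ Fl Fs
  cont_long : Continuous Fl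
  cont_short : Continuous Fs
  sum : ∀ y, F y = Fl y + Fs y
  cont_z : Continuous z
  near : ∀ τ, ‖z τ - (s * τ) • θ‖ ≤ |τ|

lemma mem_tube_of_norm_le {s τ B : ℝ} {θ a : Euc n} {b : ℝ} (h : ‖a - (s * τ) • θ‖ ≤ b)
    (hb : b ≤ B * (1 + |τ|)) : a ∈ Metric.closedBall ((s * τ) • θ) (B * (1 + |τ|)) := by
  rw [mem_closedBall_iff_norm]
  exact h.trans hb

namespace Setting

variable {p s K : ℝ} {θ x : Euc n} {Fl Fs F : Euc n → Euc n} {z : ℝ → Euc n}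

lemma s_pos (S : Setting p s K θ x Fl Fs F z) : 0 < s := by linarith [S.one_le]

lemma cont_F (S : Setting p s K θ x Fl Fs F z) : Continuous F := by
  rw [funext S.sum]
  exact S.cont_long.add S.cont_short

lemma mem_z (S : Setting p s K θ x Fl Fs F z) (τ : ℝ) :
    z τ ∈ Metric.closedBall ((s * τ) • θ) ((‖x‖ + 3) * (1 + |τ|)) :=
  mem_tube_of_norm_le (S.near τ) (by
    have := mul_nonneg (norm_nonneg x) (abs_nonneg τ)
    nlinarith [norm_nonneg x, abs_nonneg τ])

lemma mem_z_add (S : Setting p s K θ x Fl Fs F z) (τ : ℝ) :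
    z τ + x ∈ Metric.closedBall ((s * τ) • θ) ((‖x‖ + 3) * (1 + |τ|)) := by
  have hx := mul_nonneg (norm_nonneg x) (abs_nonneg τ)
  refine mem_tube_of_norm_le (b := |τ| + ‖x‖) ?_ (by nlinarith [norm_nonneg x, abs_nonneg τ])
  rw [show z τ + x - (s * τ) • θ = (z τ - (s * τ) • θ) + x by abel]
  exact (norm_add_le _ _).trans (by linarith [S.near τ])

lemma mem_z_add_add (S : Setting p s K θ x Fl Fs F z) {f : ℝ → Euc n} (hf : Dominated f) (τ : ℝ) :
    z τ + x + f τ ∈ Metric.closedBall ((s * τ) • θ) ((‖x‖ + 3) * (1 + |τ|)) := by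
  have hx := mul_nonneg (norm_nonneg x) (abs_nonneg τ)
  refine mem_tube_of_norm_le (b := |τ| + ‖x‖ + (1 + |τ|)) ?_
    (by nlinarith [norm_nonneg x, abs_nonneg τ])
  rw [show z τ + x + f τ - (s * τ) • θ = (z τ - (s * τ) • θ) + x + f τ by abel]
  exact norm_add₃_le.trans (by linarith [S.near τ, hf.2 τ, growth_le τ])

lemma wt_nonneg (S : Setting p s K θ x Fl Fs F z) (q τ : ℝ) : 0 ≤ wt q s τ :=
  Paper.wt_nonneg S.s_pos.le q τ

lemma continuous_forcing (S : Setting p s K θ x Fl Fs F z) {f : ℝ → Euc n} (hf : Continuous f) :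
    Continuous fun τ => F (z τ + x + f τ) - Fl (z τ) :=
  (S.cont_F.comp ((S.cont_z.add_const x).add hf)).sub (S.cont_long.comp S.cont_z)

lemma norm_forcing_le (S : Setting p s K θ x Fl Fs F z) {f : ℝ → Euc n} (hf : Dominated f) (τ : ℝ) :
    ‖F (z τ + x + f τ) - Fl (z τ)‖ ≤ K * (‖x‖ + 2) * (growth τ * wt (p + 1) s τ) := by
  have h1 := S.tube.long_sub τ _ (S.mem_z_add_add hf τ) _ (S.mem_z τ)
  have h2 := S.tube.short τ _ (S.mem_z_add_add hf τ)
  have h3 : ‖z τ + x + f τ - z τ‖ ≤ ‖x‖ + growth τ := by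
    rw [show z τ + x + f τ - z τ = x + f τ by abel]
    exact (norm_add_le _ _).trans (by linarith [hf.2 τ])
  have hw : 0 ≤ K * wt (p + 1) s τ := mul_nonneg S.nonneg (S.wt_nonneg _ τ)
  rw [S.sum, show Fl (z τ + x + f τ) + Fs (z τ + x + f τ) - Fl (z τ) =
    (Fl (z τ + x + f τ) - Fl (z τ)) + Fs (z τ + x + f τ) by abel]
  calc _ ≤ K * wt (p + 1) s τ * (‖x‖ + growth τ) + K * wt (p + 1) s τ :=
        (norm_add_le _ _).trans
          (add_le_add (h1.trans (mul_le_mul_of_nonneg_left h3 hw)) h2)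
    _ = K * wt (p + 1) s τ * (‖x‖ + growth τ + 1) := by ring
    _ ≤ K * wt (p + 1) s τ * ((‖x‖ + 2) * growth τ) := by
        refine mul_le_mul_of_nonneg_left ?_ hw
        nlinarith [one_le_growth τ, norm_nonneg x]
    _ = _ := by ring

lemma norm_forcing_sub_le (S : Setting p s K θ x Fl Fs F z) {f g : ℝ → Euc n} (hf : Dominated f)
    (hg : Dominated g) {d : ℝ} (hd : ∀ t, ‖f t - g t‖ ≤ d * growth t) (τ : ℝ) :
    ‖F (z τ + x + f τ) - Fl (z τ) - (F (z τ + x + g τ) - Fl (z τ))‖ ≤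
      2 * K * d * (growth τ * wt (p + 1) s τ) := by
  have h1 := S.tube.long_sub τ _ (S.mem_z_add_add hf τ) _ (S.mem_z_add_add hg τ)
  have h2 := S.tube.short_sub τ _ (S.mem_z_add_add hf τ) _ (S.mem_z_add_add hg τ)
  have hw : 0 ≤ K * wt (p + 1) s τ := mul_nonneg S.nonneg (S.wt_nonneg _ τ)
  have h3 := mul_le_mul_of_nonneg_left (hd τ) hw
  rw [show z τ + x + f τ - (z τ + x + g τ) = f τ - g τ by abel] at h1 h2
  rw [S.sum, S.sum, show Fl (z τ + x + f τ) + Fs (z τ + x + f τ) - Fl (z τ) -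
    (Fl (z τ + x + g τ) + Fs (z τ + x + g τ) - Fl (z τ)) =
    (Fl (z τ + x + f τ) - Fl (z τ + x + g τ)) + (Fs (z τ + x + f τ) - Fs (z τ + x + g τ)) by abel]
  refine (norm_add_le _ _).trans ?_
  linarith

lemma norm_Aop_le (S : Setting p s K θ x Fl Fs F z) {f : ℝ → Euc n} (hf : Dominated f) (t : ℝ) :
    ‖Aop Fl F z x f t‖ ≤ K * (‖x‖ + 2) * mass p / s * growth t :=
  norm_integral_integral_Iic_le_growth S.one_lt S.one_le
    (mul_nonneg S.nonneg (by positivity)) (S.continuous_forcing hf.1) (S.norm_forcing_le hf) t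

lemma hasDerivAt_Aop (S : Setting p s K θ x Fl Fs F z) {f : ℝ → Euc n} (hf : Dominated f) (t : ℝ) :
    HasDerivAt (Aop Fl F z x f) (∫ τ in Iic t, (F (z τ + x + f τ) - Fl (z τ))) t :=
  hasDerivAt_integral_integral_Iic S.one_lt S.one_le
    (mul_nonneg S.nonneg (by positivity)) (S.continuous_forcing hf.1) (S.norm_forcing_le hf) t

lemma continuous_Aop (S : Setting p s K θ x Fl Fs F z) {f : ℝ → Euc n} (hf : Dominated f) :
    Continuous (Aop Fl F z x f) :=
  continuous_iff_continuousAt.2 fun t => (S.hasDerivAt_Aop hf t).continuousAt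

lemma halfContracting_Aop (S : Setting p s K θ x Fl Fs F z) (hs : 4 * K * mass p ≤ s) :
    HalfContracting (Aop Fl F z x) := by
  intro f g hf hg d hd hfg t
  have hK := S.nonneg
  have hs0 := S.s_pos
  have hM : 0 ≤ K * (‖x‖ + 2) := by positivity
  have hcont := (S.continuous_forcing hf.1).sub (S.continuous_forcing hg.1)
  unfold Aop
  rw [integral_integral_Iic_sub S.one_lt S.one_le hM (S.continuous_forcing hf.1)
    (S.norm_forcing_le hf) hM (S.continuous_forcing hg.1) (S.norm_forcing_le hg)]
  refine (norm_integral_integral_Iic_le_growth S.one_lt S.one_le (by positivity) hcont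
    (S.norm_forcing_sub_le hf hg hfg) t).trans ?_
  refine mul_le_mul_of_nonneg_right ?_ (growth_pos t).le
  rw [div_le_div_iff₀ hs0 two_pos]
  nlinarith

lemma existsUnique_fixedPoint (S : Setting p s K θ x Fl Fs F z) (hs : 4 * K * mass p ≤ s)
    {r : ℝ} (hr1 : r < 1) (hsr : K * (‖x‖ + 2) * mass p / s ≤ r / 2) :
    ∃! y : ℝ → Euc n, MemM r y ∧ Aop Fl F z x y = y := by
  have hle : ∀ f : ℝ → Euc n, Dominated f → ∀ t, ‖Aop Fl F z x f t‖ ≤ r / 2 * growth t :=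
    fun f hf t =>
    (S.norm_Aop_le hf t).trans (mul_le_mul_of_nonneg_right hsr (growth_pos t).le)
  have hmem : ∀ f : ℝ → Euc n, MemM r f → Dominated f := fun f hf => ⟨hf.1, fun t =>
    (hf.norm_le t).trans (by nlinarith [growth_pos t])⟩
  obtain ⟨y, hy, hAy⟩ := (S.halfContracting_Aop hs).exists_fixedPoint fun f hf =>
    ⟨S.continuous_Aop hf, fun t => (hle f hf t).trans (by nlinarith [growth_pos t])⟩
  refine ⟨y, ⟨memM_of_norm_le hy.1 fun t => ?_, hAy⟩, ?_⟩
  · have := hle y hy t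
    rwa [hAy] at this
  · rintro w ⟨hw, hAw⟩
    exact (S.halfContracting_Aop hs).fixedPoint_unique (hmem w hw) hy hAw hAy

/-- Bounds on a dominated fixed point of the operator. -/
lemma norm_fixedPoint_le (S : Setting p s K θ x Fl Fs F z) {y : ℝ → Euc n} (hy : Dominated y)
    (hAy : Aop Fl F z x y = y) {t : ℝ} (ht : t ≤ 0) :
    ‖y t‖ ≤ K * (‖x‖ + 2) * mass p / s ^ 2 := by
  have h := norm_integral_integral_Iic_le S.one_lt S.one_le
    (mul_nonneg S.nonneg (by positivity)) (S.continuous_forcing hy.1) (S.norm_forcing_le hy) t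
  change ‖Aop Fl F z x y t‖ ≤ _ at h
  rw [hAy, max_eq_right ht, zero_add] at h
  refine h.trans (le_of_eq ?_)
  have := S.s_pos
  field_simp

lemma norm_F_le (S : Setting p s K θ x Fl Fs F z) {y : ℝ → Euc n} (hy : Dominated y) (τ : ℝ) :
    ‖F (z τ + x + y τ)‖ ≤ 2 * K * wt p s τ := by
  rw [S.sum]
  have h1 := S.tube.long τ _ (S.mem_z_add_add hy τ)
  have h2 := S.tube.short τ _ (S.mem_z_add_add hy τ)
  have h3 := mul_le_mul_of_nonneg_left (wt_anti S.s_pos.le p τ) S.nonneg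
  exact (norm_add_le _ _).trans (by linarith)

lemma integrable_F (S : Setting p s K θ x Fl Fs F z) {y : ℝ → Euc n} (hy : Dominated y) :
    Integrable fun τ => F (z τ + x + y τ) :=
  ((integrable_wt S.one_lt S.s_pos).const_mul (2 * K)).mono'
    (S.cont_F.comp ((S.cont_z.add_const x).add hy.1)).aestronglyMeasurable
    (Eventually.of_forall (S.norm_F_le hy))

lemma norm_integral_F_le (S : Setting p s K θ x Fl Fs F z) {y : ℝ → Euc n} (hy : Dominated y) :
    ‖∫ τ, F (z τ + x + y τ)‖ ≤ 2 * K * mass p / s := by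
  refine (norm_integral_le_of_norm_le ((integrable_wt S.one_lt S.s_pos).const_mul (2 * K))
    (Eventually.of_forall (S.norm_F_le hy))).trans (le_of_eq ?_)
  rw [integral_const_mul, integral_wt p S.s_pos]
  ring

lemma integrable_Fl (S : Setting p s K θ x Fl Fs F z) : Integrable fun τ => Fl (z τ) :=
  ((integrable_wt S.one_lt S.s_pos).const_mul K).mono'
    (S.cont_long.comp S.cont_z).aestronglyMeasurable
    (Eventually.of_forall fun τ => S.tube.long τ _ (S.mem_z τ))

lemma mem_outgoing {w : Euc n} {zp : ℝ → Euc n}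
    (hw : ‖w‖ ≤ 1) (hzp : ∀ τ, ‖zp τ - τ • (s • θ + w)‖ ≤ |τ|) (τ : ℝ) :
    ‖zp τ - (s * τ) • θ‖ ≤ 2 * |τ| ∧
    zp τ ∈ Metric.closedBall ((s * τ) • θ) ((‖x‖ + 3) * (1 + |τ|)) ∧
    zp τ + x ∈ Metric.closedBall ((s * τ) • θ) ((‖x‖ + 3) * (1 + |τ|)) := by
  have h : ‖zp τ - (s * τ) • θ‖ ≤ 2 * |τ| := by
    rw [show zp τ - (s * τ) • θ = (zp τ - τ • (s • θ + w)) + τ • w by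
      rw [smul_add, smul_smul, mul_comm s]; abel]
    refine (norm_add_le _ _).trans ?_
    rw [norm_smul, Real.norm_eq_abs]
    nlinarith [hzp τ, abs_nonneg τ]
  have hx := mul_nonneg (norm_nonneg x) (abs_nonneg τ)
  refine ⟨h, mem_tube_of_norm_le h (by nlinarith [norm_nonneg x, abs_nonneg τ]),
    mem_tube_of_norm_le (b := 2 * |τ| + ‖x‖) ?_ (by nlinarith [norm_nonneg x, abs_nonneg τ])⟩
  rw [show zp τ + x - (s * τ) • θ = (zp τ - (s * τ) • θ) + x by abel]
  exact (norm_add_le _ _).trans (by linarith)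

/-- The perturbed trajectory stays close to the outgoing free one for positive times. -/
lemma norm_sub_outgoing_le (S : Setting p s K θ x Fl Fs F z) {y : ℝ → Euc n} (hy : Dominated y)
    (hAy : Aop Fl F z x y = y) {zp : ℝ → Euc n} (hz : ContDiff ℝ 2 z)
    (hz2 : ∀ t, deriv (deriv z) t = Fl (z t)) (hz0 : z 0 = 0)
    (hzlim : Tendsto (deriv z) atBot (𝓝 (s • θ))) (hzp : ContDiff ℝ 2 zp)
    (hzp2 : ∀ t, deriv (deriv zp) t = Fl (zp t)) (hzp0 : zp 0 = 0)
    (hzplim : Tendsto (deriv zp) atTop (𝓝 (s • θ + ∫ τ, F (z τ + x + y τ))))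
    (hw : ‖∫ τ, F (z τ + x + y τ)‖ ≤ 1)
    (hzpn : ∀ τ, ‖zp τ - τ • (s • θ + ∫ τ, F (z τ + x + y τ))‖ ≤ |τ|)
    (hsmall : K * mass p / s ^ 2 ≤ 1 / 2) {t : ℝ} (ht : 0 ≤ t) :
    ‖z t + y t - zp t‖ ≤ 4 * (K * (‖x‖ + 2) * mass p) / s ^ 2 := by
  have d1 : ∀ {f : ℝ → Euc n}, ContDiff ℝ 2 f → ∀ t, HasDerivAt f (deriv f t) t := fun hf t =>
    (hf.differentiable (by norm_num) t).hasDerivAt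
  have d2 : ∀ {f : ℝ → Euc n}, ContDiff ℝ 2 f → ∀ t, HasDerivAt (deriv f) (deriv (deriv f) t) t :=
    fun hf t => ((((contDiff_succ_iff_deriv (n := 1)).1 hf).2.2.differentiable
      (by norm_num)) t).hasDerivAt
  have hgi := integrable_of_growth_bound S.one_lt S.one_le
    (mul_nonneg S.nonneg (by positivity)) (S.continuous_forcing hy.1) (S.norm_forcing_le hy)
  have hIic : ∀ {f : ℝ → Euc n}, Integrable f →
      Tendsto (fun t => ∫ τ in Iic t, f τ) atTop (𝓝 (∫ τ, f τ)) := fun hf =>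
    (aecover_Iic tendsto_id).integral_tendsto_of_countably_generated hf
  have hz2' : deriv (deriv z) = fun t => Fl (z t) := funext hz2
  have hzt : ∀ t, deriv z t = s • θ + ∫ τ in Iic t, Fl (z τ) := fun t => by
    have := integral_Iic_of_hasDerivAt_of_tendsto (d2 hz t).continuousAt.continuousWithinAt
      (fun τ _ => d2 hz τ) (by rw [hz2']; exact S.integrable_Fl.integrableOn) hzlim
    rw [hz2'] at this
    rw [this]
    abel
  set D : ℝ → Euc n := fun t =>
    deriv z t + (∫ τ in Iic t, (F (z τ + x + y τ) - Fl (z τ))) - deriv zp t with hD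
  have hlim : Tendsto D atTop (𝓝 0) := by
    have h1 : Tendsto (deriv z) atTop (𝓝 (s • θ + ∫ τ, Fl (z τ))) := by
      rw [funext hzt]
      exact (hIic S.integrable_Fl).const_add _
    have h2 := (h1.add (hIic hgi)).sub hzplim
    rw [integral_sub (S.integrable_F hy) S.integrable_Fl] at h2
    convert h2 using 2
    abel
  have hδ : ∀ t, HasDerivAt (fun t => z t + y t - zp t) (D t) t := fun t => by
    have := S.hasDerivAt_Aop hy t
    rw [hAy] at this
    exact ((d1 hz t).add this).sub (d1 hzp t)
  have hcz : Continuous zp := hzp.continuous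
  have hDd : ∀ t, HasDerivAt D (F (z t + x + y t) - Fl (zp t)) t := fun t => by
    have h1 := d2 hz t
    have h2 := d2 hzp t
    rw [hz2] at h1
    rw [hzp2] at h2
    have h3 := hasDerivAt_integral_Iic (S.continuous_forcing hy.1) (fun t => hgi.integrableOn) t
    exact ((h1.add h3).sub h2).congr_deriv (by abel)
  have hhc : Continuous fun t => F (z t + x + y t) - Fl (zp t) :=
    (S.cont_F.comp ((S.cont_z.add_const x).add hy.1)).sub (S.cont_long.comp hcz)
  have hb : ∀ τ, 0 ≤ τ → ‖F (z τ + x + y τ) - Fl (zp τ)‖ ≤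
      K * wt (p + 1) s τ * ((‖x‖ + 1) + ‖z τ + y τ - zp τ‖) := fun τ _ => by
    have h1 := S.tube.long_sub τ _ (S.mem_z_add_add hy τ) _ (mem_outgoing (x := x) hw hzpn τ).2.1
    have h2 := S.tube.short τ _ (S.mem_z_add_add hy τ)
    have h3 : ‖z τ + x + y τ - zp τ‖ ≤ ‖x‖ + ‖z τ + y τ - zp τ‖ := by
      rw [show z τ + x + y τ - zp τ = x + (z τ + y τ - zp τ) by abel]
      exact norm_add_le _ _
    have h4 := mul_le_mul_of_nonneg_left h3 (mul_nonneg S.nonneg (S.wt_nonneg (p + 1) τ))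
    rw [S.sum, show Fl (z τ + x + y τ) + Fs (z τ + x + y τ) - Fl (zp τ) =
      (Fl (z τ + x + y τ) - Fl (zp τ)) + Fs (z τ + x + y τ) by abel]
    refine (norm_add_le _ _).trans ?_
    linarith
  have hlin : ∀ t, 0 ≤ t → ‖z t + y t - zp t‖ ≤ 4 * (1 + t) := fun t ht => by
    have h1 := S.near t
    have h2 := (mem_outgoing (x := x) hw hzpn t).1
    have h3 := hy.2 t
    rw [growth_of_nonneg ht] at h3
    rw [abs_of_nonneg ht] at h1 h2
    rw [show z t + y t - zp t = (z t - (s * t) • θ) + y t - (zp t - (s * t) • θ) by abel]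
    refine (norm_sub_le _ _).trans ?_
    have := norm_add_le (z t - (s * t) • θ) (y t)
    linarith
  have main := norm_le_of_second_order S.one_lt S.s_pos S.nonneg (by positivity) hδ hDd hhc hlim hb
    (by norm_num) hlin hsmall ht
  have hy0 := S.norm_fixedPoint_le hy hAy le_rfl
  simp only [hz0, hzp0, zero_add, sub_zero] at main
  have h5 : 0 ≤ K * mass p / s ^ 2 := by
    have := S.nonneg
    have := mass_nonneg p
    positivity
  have e1 : K * (‖x‖ + 2) * mass p / s ^ 2 = K * mass p / s ^ 2 * (‖x‖ + 2) := by ring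
  have e2 : 4 * (K * (‖x‖ + 2) * mass p) / s ^ 2 = 4 * (K * mass p / s ^ 2 * (‖x‖ + 2)) := by ring
  rw [e1] at hy0
  rw [e2]
  nlinarith

end Setting

namespace Setting

variable {p s K : ℝ} {θ x : Euc n} {Fl Fs F : Euc n → Euc n} {z : ℝ → Euc n}

lemma norm_smul_short_le (S : Setting p s K θ x Fl Fs F z) {y : ℝ → Euc n} (hy : Dominated y)
    (τ : ℝ) : ‖τ • Fs (z τ + x + y τ)‖ ≤ K / s * wt p s τ := by
  rw [norm_smul, Real.norm_eq_abs]
  calc |τ| * ‖Fs (z τ + x + y τ)‖ ≤ |τ| * (K * wt (p + 1) s τ) :=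
        mul_le_mul_of_nonneg_left (S.tube.short τ _ (S.mem_z_add_add hy τ)) (abs_nonneg τ)
    _ = K * (|τ| * wt (p + 1) s τ) := by ring
    _ ≤ K * (wt p s τ / s) := mul_le_mul_of_nonneg_left (abs_mul_wt_le S.s_pos p τ) S.nonneg
    _ = _ := by ring

lemma norm_smul_long_sub_le (S : Setting p s K θ x Fl Fs F z) {τ d : ℝ} {a b : Euc n}
    (ha : a ∈ Metric.closedBall ((s * τ) • θ) ((‖x‖ + 3) * (1 + |τ|)))
    (hb : b ∈ Metric.closedBall ((s * τ) • θ) ((‖x‖ + 3) * (1 + |τ|))) (hd : ‖a - b‖ ≤ d) :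
    ‖τ • (Fl a - Fl b)‖ ≤ K * d / s * wt p s τ := by
  rw [norm_smul, Real.norm_eq_abs]
  have hd0 : 0 ≤ d := (norm_nonneg _).trans hd
  have hw := S.wt_nonneg (p + 1) τ
  have hK := S.nonneg
  calc |τ| * ‖Fl a - Fl b‖ ≤ |τ| * (K * wt (p + 1) s τ * d) := by
        gcongr
        exact (S.tube.long_sub τ a ha b hb).trans (by gcongr)
    _ = K * d * (|τ| * wt (p + 1) s τ) := by ring
    _ ≤ K * d * (wt p s τ / s) := by
        gcongr
        exact abs_mul_wt_le S.s_pos p τ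
    _ = _ := by ring

/-- Up to a small error, the defect between the scattering displacement and its long-range
approximation is the first moment of the short-range force along the trajectory. -/
lemma norm_defect_add_integral_le (S : Setting p s K θ x Fl Fs F z) {y zp : ℝ → Euc n}
    (hy : Dominated y) (hzp : Continuous zp)
    (hmem : ∀ τ, zp τ + x ∈ Metric.closedBall ((s * τ) • θ) ((‖x‖ + 3) * (1 + |τ|)))
    {d : ℝ} (hneg : ∀ t ≤ 0, ‖y t‖ ≤ d) (hpos : ∀ t, 0 ≤ t → ‖z t + y t - zp t‖ ≤ d) :
    ‖lInt Fl Fs F z x y + l1Int Fl zp x + l2Int Fl z zp x y - Wvec Fl z zp x +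
      ∫ τ, τ • Fs (z τ + x + y τ)‖ ≤ 2 * (K * d * mass p / s ^ 2) := by
  have hs := S.s_pos
  have hK := S.nonneg
  have hcw : Continuous fun τ => z τ + x + y τ := (S.cont_z.add_const x).add hy.1
  have hcs : Continuous fun τ => Fs (z τ + x + y τ) := S.cont_short.comp hcw
  have hcl : Continuous fun τ => Fl (z τ + x + y τ) - Fl (z τ + x) :=
    (S.cont_long.comp hcw).sub (S.cont_long.comp (S.cont_z.add_const x))
  have hcr : Continuous fun τ => Fl (z τ + x + y τ) - Fl (zp τ + x) :=
    (S.cont_long.comp hcw).sub (S.cont_long.comp (hzp.add_const x))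
  have hcd : Continuous fun τ => Fl (z τ + x) - Fl (z τ) :=
    (S.cont_long.comp (S.cont_z.add_const x)).sub (S.cont_long.comp S.cont_z)
  have hwi := integrable_wt S.one_lt S.s_pos
  have hsi : Integrable fun τ => τ • Fs (z τ + x + y τ) :=
    (hwi.const_mul (K / s)).mono' (continuous_id.smul hcs).aestronglyMeasurable
      (Eventually.of_forall (S.norm_smul_short_le hy))
  have bl : ∀ τ ≤ 0, ‖τ • (Fl (z τ + x + y τ) - Fl (z τ + x))‖ ≤ K * d / s * wt p s τ :=
    fun τ hτ => S.norm_smul_long_sub_le (S.mem_z_add_add hy τ) (S.mem_z_add τ) (by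
      rw [add_sub_cancel_left]
      exact hneg τ hτ)
  have br : ∀ τ, 0 ≤ τ → ‖τ • (Fl (z τ + x + y τ) - Fl (zp τ + x))‖ ≤ K * d / s * wt p s τ :=
    fun τ hτ => S.norm_smul_long_sub_le (S.mem_z_add_add hy τ) (hmem τ) (by
      rw [show z τ + x + y τ - (zp τ + x) = z τ + y τ - zp τ by abel]
      exact hpos τ hτ)
  have ebl := (ae_restrict_mem (μ := volume) (measurableSet_Iic (a := (0 : ℝ)))).mono bl
  have ebr := (ae_restrict_mem (μ := volume) (measurableSet_Ioi (a := (0 : ℝ)))).mono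
    fun τ hτ => br τ (le_of_lt hτ)
  have hli : IntegrableOn (fun τ => τ • (Fl (z τ + x + y τ) - Fl (z τ + x))) (Iic 0) :=
    Integrable.mono' (hwi.const_mul (K * d / s)).integrableOn
      (continuous_id.smul hcl).aestronglyMeasurable ebl
  have hri : IntegrableOn (fun τ => τ • (Fl (z τ + x + y τ) - Fl (zp τ + x))) (Ioi 0) :=
    Integrable.mono' (hwi.const_mul (K * d / s)).integrableOn
      (continuous_id.smul hcr).aestronglyMeasurable ebr
  have h_int : ∀ A : Set ℝ, ∫ τ in A, K * d / s * wt p s τ ≤ K * d * mass p / s ^ 2 := fun A => by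
    have hd : 0 ≤ d := (norm_nonneg _).trans (hneg 0 le_rfl)
    refine (setIntegral_le_integral (hwi.const_mul _) (Eventually.of_forall fun τ =>
      mul_nonneg (by positivity) (S.wt_nonneg p τ))).trans (le_of_eq ?_)
    rw [integral_const_mul, integral_wt p hs]
    field_simp
  have e1 : (∫ σ in Iic (0 : ℝ), ∫ τ in Iic σ, (F (z τ + x + y τ) - Fl (z τ))) -
      (∫ σ in Iic (0 : ℝ), ∫ τ in Iic σ, (Fl (z τ + x) - Fl (z τ))) =
      -(∫ τ in Iic 0, τ • Fs (z τ + x + y τ)) -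
        ∫ τ in Iic 0, τ • (Fl (z τ + x + y τ) - Fl (z τ + x)) := by
    rw [integral_integral_Iic_sub S.one_lt S.one_le (mul_nonneg hK (by positivity))
      (S.continuous_forcing hy.1) (S.norm_forcing_le hy) (M' := K * ‖x‖) (by positivity)
      hcd
      (fun τ => ?_)]
    · have hfun : ∀ τ, F (z τ + x + y τ) - Fl (z τ) - (Fl (z τ + x) - Fl (z τ)) =
          Fs (z τ + x + y τ) + (Fl (z τ + x + y τ) - Fl (z τ + x)) := fun τ => by
        rw [S.sum]; abel
      have hcsl : AEStronglyMeasurable fun τ =>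
          Fs (z τ + x + y τ) + (Fl (z τ + x + y τ) - Fl (z τ + x)) :=
        (hcs.add hcl).aestronglyMeasurable
      simp only [hfun]
      have hfun' : ∀ τ : ℝ, (0 - τ) • (Fs (z τ + x + y τ) + (Fl (z τ + x + y τ) - Fl (z τ + x))) =
          -(τ • Fs (z τ + x + y τ)) - τ • (Fl (z τ + x + y τ) - Fl (z τ + x)) := fun τ => by
        rw [zero_sub, neg_smul, smul_add]; abel
      have hsn : IntegrableOn (fun τ => -(τ • Fs (z τ + x + y τ))) (Iic 0) := hsi.integrableOn.neg
      rw [integral_integral_Iic hcsl]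
      · simp only [hfun']
        rw [integral_sub hsn hli, integral_neg]
      · simp only [hfun']
        exact hsn.sub hli
    · refine (S.tube.long_sub τ _ (S.mem_z_add τ) _ (S.mem_z τ)).trans ?_
      rw [add_sub_cancel_left]
      have := mul_le_mul_of_nonneg_left (one_le_growth τ)
        (mul_nonneg (mul_nonneg hK (S.wt_nonneg (p + 1) τ)) (norm_nonneg x))
      linarith
  have e2 : lInt Fl Fs F z x y + l1Int Fl zp x + l2Int Fl z zp x y - Wvec Fl z zp x +
      ∫ τ, τ • Fs (z τ + x + y τ) =
      -(∫ τ in Iic 0, τ • (Fl (z τ + x + y τ) - Fl (z τ + x))) -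
        ∫ τ in Ioi 0, τ • (Fl (z τ + x + y τ) - Fl (zp τ + x)) := by
    have e3 := intervalIntegral.integral_Iic_add_Ioi hsi.integrableOn hsi.integrableOn (b := 0)
    unfold lInt l1Int l2Int Wvec
    rw [integral_integral_Ici hcs.aestronglyMeasurable hsi.integrableOn,
      integral_integral_Ici hcr.aestronglyMeasurable hri, ← e3]
    rw [sub_eq_iff_eq_add] at e1
    rw [e1]
    abel
  rw [e2]
  refine (norm_sub_le _ _).trans ?_
  rw [norm_neg, two_mul]
  exact add_le_add
    ((norm_integral_le_of_norm_le (hwi.const_mul _).integrableOn ebl).trans (h_int _))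
    ((norm_integral_le_of_norm_le (hwi.const_mul _).integrableOn ebr).trans (h_int _))

end Setting

section Moments

/-- The rescaled first moment of the short-range force along a family of trajectories converges
to the first moment along the straight line. -/
lemma tendsto_smul_integral_short {p K : ℝ} {θ x : Euc n} {Fl Fs F : Euc n → Euc n}
    {z y : ℝ → ℝ → Euc n} (h : ∀ᶠ s in atTop, Setting p s K θ x Fl Fs F (z s) ∧
      Dominated (y s) ∧ Aop Fl F (z s) x (y s) = y s) :
    Tendsto (fun s : ℝ => s ^ 2 • ∫ τ : ℝ, τ • Fs (z s τ + x + y s τ)) atTop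
      (𝓝 (∫ u : ℝ, u • Fs (u • θ + x))) := by
  obtain ⟨s₀, S₀, -⟩ := h.exists
  have hev : (fun s : ℝ => ∫ u : ℝ, u • Fs (z s (s⁻¹ * u) + x + y s (s⁻¹ * u))) =ᶠ[atTop]
      fun s : ℝ => s ^ 2 • ∫ τ : ℝ, τ • Fs (z s τ + x + y s τ) := by
    filter_upwards [eventually_gt_atTop 0] with s hs
    have e := Measure.integral_comp_mul_left (fun τ => (s * τ) • Fs (z s τ + x + y s τ)) s⁻¹
    simp only [mul_inv_cancel_left₀ hs.ne', inv_inv, abs_of_pos hs, mul_smul] at e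
    rw [e, integral_smul, smul_smul, pow_two]
  refine Tendsto.congr' hev ?_
  refine tendsto_integral_filter_of_dominated_convergence (fun u => K * wt p 1 u) ?_ ?_
    ((integrable_wt S₀.one_lt one_pos).const_mul K) (Eventually.of_forall fun u => ?_)
  · filter_upwards [h] with s ⟨S, hy, _⟩
    have hc : Continuous fun u => z s (s⁻¹ * u) + x + y s (s⁻¹ * u) :=
      ((S.cont_z.add_const x).add hy.1).comp (continuous_const_mul s⁻¹)
    exact (continuous_id.smul (S.cont_short.comp hc)).aestronglyMeasurable
  · filter_upwards [h] with s ⟨S, hy, _⟩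
    refine Eventually.of_forall fun u => ?_
    have hs := S.s_pos
    have h1 := S.norm_smul_short_le hy (s⁻¹ * u)
    rw [mul_smul, norm_smul, Real.norm_of_nonneg (by positivity), wt_eq_comp p hs.le] at h1
    simp only [mul_inv_cancel_left₀ hs.ne'] at h1
    rw [inv_mul_le_iff₀ hs] at h1
    refine h1.trans (le_of_eq ?_)
    field_simp
  · refine Tendsto.const_smul ?_ u
    refine S₀.cont_short.continuousAt.tendsto.comp ?_
    rw [tendsto_iff_norm_sub_tendsto_zero]
    set C := |u| + K * (‖x‖ + 2) * mass p * (1 + |u|) with hC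
    have hl : Tendsto (fun s : ℝ => C * s⁻¹) atTop (𝓝 (C * 0)) :=
      tendsto_inv_atTop_zero.const_mul C
    rw [mul_zero] at hl
    refine squeeze_zero' (Eventually.of_forall fun s => norm_nonneg _) ?_ hl
    filter_upwards [h] with s ⟨S, hy, hAy⟩
    have hs := S.s_pos
    have h1 := S.near (s⁻¹ * u)
    have h2 := S.norm_Aop_le hy (s⁻¹ * u)
    rw [hAy] at h2
    rw [mul_inv_cancel_left₀ hs.ne'] at h1
    have hi : s⁻¹ ≤ 1 := inv_le_one_of_one_le₀ S.one_le
    have h3 : |s⁻¹ * u| = s⁻¹ * |u| := by rw [abs_mul, abs_of_pos (by positivity)]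
    have h4 : growth (s⁻¹ * u) ≤ 1 + |u| := by
      refine (growth_le _).trans ?_
      rw [h3]
      nlinarith [abs_nonneg u]
    have h5 : 0 ≤ K * (‖x‖ + 2) * mass p / s := by
      have := S.nonneg
      have := mass_nonneg p
      positivity
    have h6 := mul_le_mul_of_nonneg_left h4 h5
    rw [show z s (s⁻¹ * u) + x + y s (s⁻¹ * u) - (u • θ + x) =
      (z s (s⁻¹ * u) - u • θ) + y s (s⁻¹ * u) by abel]
    refine (norm_add_le _ _).trans ?_
    calc _ ≤ s⁻¹ * |u| + K * (‖x‖ + 2) * mass p / s * (1 + |u|) := by linarith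
      _ = C * s⁻¹ := by rw [hC]; ring

variable {E : Type*} [NormedAddCommGroup E] [InnerProductSpace ℝ E] {θ x : E}

lemma abs_le_norm_smul_add (hθ : ‖θ‖ = 1) (hperp : ⟪θ, x⟫ = 0) (u : ℝ) : |u| ≤ ‖u • θ + x‖ := by
  have h := abs_real_inner_le_norm θ (u • θ + x)
  rwa [inner_add_right, inner_smul_right, real_inner_self_eq_norm_sq, hθ, hperp, one_pow, mul_one,
    add_zero, one_mul] at h

lemma rpow_norm_smul_add_le (hθ : ‖θ‖ = 1) (hperp : ⟪θ, x⟫ = 0) {q : ℝ} (hq : 0 ≤ q) (u : ℝ) :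
    (1 + ‖u • θ + x‖) ^ (-q) ≤ wt q 1 u := by
  unfold wt
  rw [one_mul]
  exact Real.rpow_le_rpow_of_nonpos (by positivity)
    (by linarith [abs_le_norm_smul_add hθ hperp u]) (by linarith)

variable [CompleteSpace E]

lemma integrable_smul_gradient {V : E → ℝ} (hV : ContDiff ℝ 2 V) {p γ : ℝ} (hp : 1 < p)
    (hγ : 0 ≤ γ) (h1 : ∀ y, ‖gradient V y‖ ≤ γ * (1 + ‖y‖) ^ (-(p + 1))) (hθ : ‖θ‖ = 1)
    (hperp : ⟪θ, x⟫ = 0) : Integrable fun u : ℝ => u • gradient V (u • θ + x) := by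
  have hc : Continuous fun u : ℝ => u • gradient V (u • θ + x) :=
    continuous_id.smul ((continuous_gradient hV).comp (by fun_prop))
  refine ((integrable_wt hp one_pos).const_mul γ).mono' hc.aestronglyMeasurable
    (Eventually.of_forall fun u => ?_)
  rw [norm_smul, Real.norm_eq_abs]
  have h2 := rpow_norm_smul_add_le hθ hperp (by linarith : 0 ≤ p + 1) u
  have h3 := abs_mul_wt_le one_pos p u
  rw [div_one] at h3
  calc |u| * ‖gradient V (u • θ + x)‖ ≤ |u| * (γ * wt (p + 1) 1 u) :=
        mul_le_mul_of_nonneg_left ((h1 _).trans (mul_le_mul_of_nonneg_left h2 hγ)) (abs_nonneg u)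
    _ = γ * (|u| * wt (p + 1) 1 u) := by ring
    _ ≤ _ := mul_le_mul_of_nonneg_left h3 hγ

/-- Integration by parts for a decaying potential along a straight line. -/
lemma inner_integral_smul_gradient {V : E → ℝ} (hV : ContDiff ℝ 2 V) {p β γ : ℝ} (hp : 1 < p)
    (hβ : 0 ≤ β) (hγ : 0 ≤ γ) (h0 : ∀ y, |V y| ≤ β * (1 + ‖y‖) ^ (-p))
    (h1 : ∀ y, ‖gradient V y‖ ≤ γ * (1 + ‖y‖) ^ (-(p + 1))) (hθ : ‖θ‖ = 1)
    (hperp : ⟪θ, x⟫ = 0) :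
    ⟪θ, ∫ u : ℝ, u • gradient V (u • θ + x)⟫ = -∫ u : ℝ, V (u • θ + x) := by
  have hVle : ∀ u : ℝ, ‖V (u • θ + x)‖ ≤ β * wt p 1 u := fun u => (h0 _).trans
    (mul_le_mul_of_nonneg_left (rpow_norm_smul_add_le hθ hperp (by linarith) u) hβ)
  have hVc : Continuous fun u : ℝ => V (u • θ + x) := hV.continuous.comp (by fun_prop)
  have hVi : Integrable fun u : ℝ => V (u • θ + x) :=
    ((integrable_wt hp one_pos).const_mul β).mono' hVc.aestronglyMeasurable
      (Eventually.of_forall hVle)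
  have hgi := integrable_smul_gradient hV hp hγ h1 hθ hperp
  have hline : ∀ u : ℝ, HasDerivAt (fun u : ℝ => V (u • θ + x)) ⟪θ, gradient V (u • θ + x)⟫ u := by
    intro u
    have hg := ((hV.differentiable (by norm_num)) (u • θ + x)).hasGradientAt.hasFDerivAt
    have hl : HasDerivAt (fun u : ℝ => u • θ + x) θ u := by
      simpa using ((hasDerivAt_id u).smul_const θ).add_const x
    have := hg.comp_hasDerivAt u hl
    rwa [InnerProductSpace.toDual_apply_apply, real_inner_comm] at this
  have hderiv : ∀ u : ℝ, HasDerivAt (fun u : ℝ => u * V (u • θ + x))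
      (V (u • θ + x) + ⟪θ, u • gradient V (u • θ + x)⟫) u := fun u =>
    ((hasDerivAt_id u).mul (hline u)).congr_deriv (by rw [inner_smul_right]; simp)
  have hbound : ∀ u : ℝ, ‖u * V (u • θ + x)‖ ≤ β * (1 + |u|) ^ (-(p - 1)) := fun u => by
    have h2 := abs_mul_wt_le one_pos (p - 1) u
    rw [sub_add_cancel, div_one] at h2
    rw [norm_mul, Real.norm_eq_abs]
    calc |u| * ‖V (u • θ + x)‖ ≤ |u| * (β * wt p 1 u) :=
          mul_le_mul_of_nonneg_left (hVle u) (abs_nonneg u)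
      _ = β * (|u| * wt p 1 u) := by ring
      _ ≤ β * wt (p - 1) 1 u := mul_le_mul_of_nonneg_left h2 hβ
      _ = _ := by unfold wt; rw [one_mul]
  have hdecay : Tendsto (fun v : ℝ => β * (1 + v) ^ (-(p - 1))) atTop (𝓝 0) := by
    have := ((tendsto_rpow_neg_atTop (by linarith : 0 < p - 1)).comp
      (tendsto_atTop_add_const_left atTop (1 : ℝ) tendsto_id)).const_mul β
    simpa using this
  have hzero : ∀ l : Filter ℝ, Tendsto (fun u : ℝ => |u|) l atTop →
      Tendsto (fun u : ℝ => u * V (u • θ + x)) l (𝓝 0) := fun l hl =>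
    squeeze_zero_norm hbound (hdecay.comp hl)
  have hinner : Integrable fun u : ℝ => ⟪θ, u • gradient V (u • θ + x)⟫ := hgi.const_inner θ
  have key := integral_of_hasDerivAt_of_tendsto hderiv (hVi.add hinner)
    (hzero _ tendsto_abs_atBot_atTop) (hzero _ tendsto_abs_atTop_atTop)
  rw [integral_add hVi hinner, integral_inner hgi] at key
  linarith

end Moments

theorem statement_8
    (n : ℕ) (hn : 2 ≤ n) (α : ℝ) (hα0 : 0 < α) (hα1 : α ≤ 1)
    (Vl Vs : Euc n → ℝ) (βl0 βl1 βl2 βs1 βs2 βs3 : ℝ)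
    (hβl0 : 0 < βl0) (hβl1 : 0 < βl1) (hβl2 : 0 < βl2)
    (hβs1 : 0 < βs1) (hβs2 : 0 < βs2) (hβs3 : 0 < βs3)
    (hVl : LongRange α βl0 βl1 βl2 Vl) (hVs : ShortRange α βs1 βs2 βs3 Vs)
    (Fl Fs F : Euc n → Euc n)
    (hFl : ∀ y, Fl y = -gradient Vl y) (hFs : ∀ y, Fs y = -gradient Vs y)
    (hF : ∀ y, F y = Fl y + Fs y)
    (θ x : Euc n) (hθ : ‖θ‖ = 1) (hperp : ⟪θ, x⟫ = 0)
    (r : ℝ) (hr0 : 0 < r) (hr1 : r < 1)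
    (zm : ℝ → ℝ → Euc n)
    (hzm : ∀ s : ℝ, Real.sqrt (2 ^ 5 * (n : ℝ) * max βl1 βl2 / α) ≤ s → IsFreeSol Fl 0 (s • θ) atBot
      (2 ^ ((5:ℝ)/2) * Real.sqrt n * βl1 / (α * s)) (zm s))
 :
    (∀ᶠ s in atTop, ∃! y : ℝ → Euc n, MemM r y ∧ Aop Fl F (zm s) x y = y) ∧
    ∀ Y : ℝ → ℝ → Euc n,
      (∀ᶠ s in atTop, MemM r (Y s) ∧ Aop Fl F (zm s) x (Y s) = Y s) →
      ∀ Zp : ℝ → ℝ → Euc n,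
        (∀ᶠ s in atTop, IsFreeSol Fl 0 (s • θ + ∫ τ : ℝ, F (zm s τ + x + Y s τ)) atTop
          (2 ^ ((5:ℝ)/2) * Real.sqrt n * βl1 / (α * s)) (Zp s)) →
        Tendsto (fun s : ℝ => s ^ 2 *
            ⟪θ, lInt Fl Fs F (zm s) x (Y s) + l1Int Fl (Zp s) x +
                l2Int Fl (zm s) (Zp s) x (Y s) - Wvec Fl (zm s) (Zp s) x⟫) atTop
          (𝓝 (-∫ τ : ℝ, Vs (τ • θ + x))) := by
  obtain ⟨hVl2, -, hl₁, hl₂⟩ := hVl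
  obtain ⟨hVs2, hs₀, hs₁, hs₂⟩ := hVs
  obtain ⟨K, hK, htube⟩ := exists_tubeBound (B := ‖x‖ + 3) hθ (by positivity) hα0.le hβl1.le
    hβl2.le hβs2.le hβs3.le hVl2 hVs2 hl₁ hl₂ hs₁ hs₂ hFl hFs
  set p := α + 1 with hp
  have hp1 : 1 < p := by linarith
  have hm := mass_nonneg p
  set Q := K * (‖x‖ + 2) * mass p with hQ
  have hcl : Continuous Fl := by rw [funext hFl]; exact (continuous_gradient hVl2).neg
  have hcs : Continuous Fs := by rw [funext hFs]; exact (continuous_gradient hVs2).neg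
  have hdiv : ∀ c ε : ℝ, 0 < ε → ∀ᶠ s : ℝ in atTop, c / s ≤ ε := fun c ε hε =>
    (tendsto_const_nhds.div_atTop tendsto_id).eventually_le_const hε
  have hC : ∀ᶠ s : ℝ in atTop, 2 ^ ((5:ℝ)/2) * Real.sqrt n * βl1 / (α * s) ≤ 1 := by
    filter_upwards [hdiv (2 ^ ((5:ℝ)/2) * Real.sqrt n * βl1 / α) 1 one_pos] with s hs
    rwa [div_div] at hs
  have hset : ∀ᶠ s : ℝ in atTop, Setting p s K θ x Fl Fs F (zm s) := by
    filter_upwards [eventually_ge_atTop (Real.sqrt (2 ^ 5 * (n : ℝ) * max βl1 βl2 / α)),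
      eventually_ge_atTop 1, eventually_ge_atTop (2 * (‖x‖ + 3)), hC] with s h1 h2 h3 h4
    obtain ⟨hz, -, -, -, hzn⟩ := hzm s h1
    refine ⟨hp1, h2, hK, htube s h3, hcl, hcs, hF, hz.continuous, fun τ => ?_⟩
    have := hzn τ
    rw [sub_zero, smul_smul, mul_comm τ] at this
    exact this.trans (mul_le_of_le_one_left (abs_nonneg τ) h4)
  refine ⟨?_, fun Y hY Zp hZp => ?_⟩
  · filter_upwards [hset, eventually_ge_atTop (4 * K * mass p), hdiv Q (r / 2) (half_pos hr0)]
      with s S h1 h2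
    exact S.existsUnique_fixedPoint h1 hr1 h2
  have hset' : ∀ᶠ s : ℝ in atTop, Setting p s K θ x Fl Fs F (zm s) ∧ Dominated (Y s) ∧
      Aop Fl F (zm s) x (Y s) = Y s := by
    filter_upwards [hset, hY] with s S ⟨hM, hA⟩
    exact ⟨S, ⟨hM.1, fun t => (hM.norm_le t).trans
      (mul_le_of_le_one_left (growth_pos t).le hr1.le)⟩, hA⟩
  set X : ℝ → Euc n := fun s => lInt Fl Fs F (zm s) x (Y s) + l1Int Fl (Zp s) x +
    l2Int Fl (zm s) (Zp s) x (Y s) - Wvec Fl (zm s) (Zp s) x with hX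
  set I : ℝ → Euc n := fun s => ∫ τ : ℝ, τ • Fs (zm s τ + x + Y s τ) with hI
  have herr : ∀ᶠ s : ℝ in atTop, ‖s ^ 2 • (X s + I s)‖ ≤ 8 * (K * Q * mass p) / s := by
    filter_upwards [hset', hZp, hC, hdiv (2 * K * mass p) 1 one_pos,
      hdiv (K * mass p) (1 / 2) (by norm_num),
      eventually_ge_atTop (Real.sqrt (2 ^ 5 * (n : ℝ) * max βl1 βl2 / α))]
      with s ⟨S, hy, hA⟩ ⟨hp2, hpd, hp0, hpl, hpn⟩ h1 h2 h3 h4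
    have hs := S.s_pos
    obtain ⟨hz2, hzd, hz0, hzl, -⟩ := hzm s h4
    have hw := (S.norm_integral_F_le hy).trans h2
    have hpn' : ∀ τ, ‖Zp s τ - τ • (s • θ + ∫ τ, F (zm s τ + x + Y s τ))‖ ≤ |τ| := fun τ => by
      have := hpn τ
      rw [sub_zero] at this
      exact this.trans (mul_le_of_le_one_left (abs_nonneg τ) h1)
    have hsmall : K * mass p / s ^ 2 ≤ 1 / 2 := by
      refine le_trans ?_ h3
      gcongr
      exact le_self_pow₀ S.one_le two_ne_zero
    have hQ0 : 0 ≤ Q := by positivity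
    have hneg : ∀ t ≤ 0, ‖Y s t‖ ≤ 4 * Q / s ^ 2 := fun t ht =>
      (S.norm_fixedPoint_le hy hA ht).trans
        (div_le_div_of_nonneg_right (by linarith) (by positivity))
    have hpos : ∀ t, 0 ≤ t → ‖zm s t + Y s t - Zp s t‖ ≤ 4 * Q / s ^ 2 := fun t ht =>
      S.norm_sub_outgoing_le hy hA hz2 hzd hz0 hzl hp2 hpd hp0 hpl hw hpn' hsmall ht
    have h := S.norm_defect_add_integral_le hy hp2.continuous
      (fun τ => (Setting.mem_outgoing hw hpn' τ).2.2) hneg hpos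
    rw [norm_smul, Real.norm_of_nonneg (by positivity)]
    calc s ^ 2 * ‖X s + I s‖ ≤ s ^ 2 * (2 * (K * (4 * Q / s ^ 2) * mass p / s ^ 2)) := by gcongr
      _ = 8 * (K * Q * mass p) / s ^ 2 := by field_simp; ring
      _ ≤ 8 * (K * Q * mass p) / s := by
        gcongr
        exact le_self_pow₀ S.one_le two_ne_zero
  have hzero : Tendsto (fun s : ℝ => s ^ 2 • (X s + I s)) atTop (𝓝 0) :=
    squeeze_zero_norm' herr (tendsto_const_nhds.div_atTop tendsto_id)
  have hlim := (tendsto_const_nhds (x := θ)).inner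
    (hzero.sub (tendsto_smul_integral_short hset')) (𝕜 := ℝ)
  have hp2 : ∀ y, ‖gradient Vs y‖ ≤ βs2 * (1 + ‖y‖) ^ (-(p + 1)) := fun y => by
    rw [hp, show α + 1 + 1 = α + 2 by ring]
    exact hs₁ y
  have hval : ⟪θ, 0 - ∫ u : ℝ, u • Fs (u • θ + x)⟫ = -∫ τ : ℝ, Vs (τ • θ + x) := by
    simp only [hFs, smul_neg, integral_neg, sub_neg_eq_add, zero_add]
    exact inner_integral_smul_gradient hVs2 hp1 hβs1.le hβs2.le hs₀ hp2 hθ hperp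
  rw [hval] at hlim
  refine hlim.congr fun s => ?_
  rw [smul_add, add_sub_cancel_right, inner_smul_right]

end Paper
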